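/- Let M be a smooth n-dimensional hypersurface of R^{n+1}, p ∈ [1,n), and φ ∈ C^1(M) with compact support in M. Then there exists C = C(n,p) > 0 such that ‖φ‖_{L^{p*}(M)}^p ≤ C ∫_M (|∇_T φ|^p + |H φ|^p) dV, where p* = np/(n−p). -/

import Mathlib

open MeasureTheory
open scoped RealInnerProductSpace

noncomputable section

/-- Ambient Euclidean space `ℝ^{n+1}`. -/
abbrev Eu (n : ℕ) := EuclideanSpace ℝ (Fin (n + 1))

/-- A smooth `n`-dimensional hypersurface of `ℝ^{n+1}`, described by its carrier set
together with a smooth unit normal field; locally it is a regular level set of a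
smooth function. -/
structure Hypersurface (n : ℕ) where
  carrier : Set (Eu n)
  nu : Eu n → Eu n
  smooth_nu : ContDiff ℝ (⊤ : ℕ∞) nu
  unit_nu : ∀ x ∈ carrier, ‖nu x‖ = 1
  locally_level_set : ∀ x ∈ carrier, ∃ U : Set (Eu n), IsOpen U ∧ x ∈ U ∧
    ∃ f : Eu n → ℝ, ContDiff ℝ (⊤ : ℕ∞) f ∧
      carrier ∩ U = {y ∈ U | f y = 0} ∧
      (∀ y ∈ U, gradient f y ≠ 0) ∧
      (∀ y ∈ carrier ∩ U, nu y = ‖gradient f y‖⁻¹ • gradient f y)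

variable {n : ℕ}

/-- The `i`-th tangential derivative `δ_i φ = ∂_i φ − ν^i ∑_j (∂_j φ) ν^j`. -/
def tderiv (ν : Eu n → Eu n) (i : Fin (n + 1)) (φ : Eu n → ℝ) (x : Eu n) : ℝ :=
  fderiv ℝ φ x (EuclideanSpace.single i 1)
    - ν x i * ∑ j, fderiv ℝ φ x (EuclideanSpace.single j 1) * ν x j

/-- The tangential gradient `∇_T φ = ∇φ − (∇φ·ν)ν`. -/
def tgrad (ν : Eu n → Eu n) (φ : Eu n → ℝ) (x : Eu n) : Eu n :=
  gradient φ x - ⟪gradient φ x, ν x⟫ • ν x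

/-- The tangential divergence `div_T Z = ∑ i δ_i Z^i`. -/
def tdiv (ν : Eu n → Eu n) (Z : Eu n → Eu n) (x : Eu n) : ℝ :=
  ∑ i, tderiv ν i (fun y => Z y i) x

/-- The mean curvature `H = div_T ν` (sum of the principal curvatures). -/
def meanCurv (M : Hypersurface n) (x : Eu n) : ℝ := tdiv M.nu M.nu x

/-- The Laplace–Beltrami operator `Δφ = div_T (∇_T φ)`. -/
def lapBel (ν : Eu n → Eu n) (φ : Eu n → ℝ) (x : Eu n) : ℝ := tdiv ν (tgrad ν φ) x

/-- The surface measure on `M`: the `n`-dimensional Hausdorff measure restricted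
to the carrier of `M`. -/
def surfMeasure (M : Hypersurface n) : Measure (Eu n) :=
  (μH[(n : ℝ)]).restrict M.carrier

/-- `C^1` functions with compact support in a set `S`: ambient `C^1` functions
vanishing on `S` outside a compact subset `K ⊆ S`. -/
def C1cOn (S : Set (Eu n)) (φ : Eu n → ℝ) : Prop :=
  ContDiff ℝ 1 φ ∧ ∃ K : Set (Eu n), IsCompact K ∧ K ⊆ S ∧ ∀ x ∈ S, x ∉ K → φ x = 0

namespace MSA
open Set Filter Topology

/-- Parameter space. -/
abbrev Ep (n : ℕ) := EuclideanSpace ℝ (Fin n)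

/-- A graph chart for a hypersurface. -/
structure Chart (M : Hypersurface n) where
  e : Eu n
  he : ‖e‖ = 1
  J : Ep n →L[ℝ] Eu n
  P : Eu n →L[ℝ] Ep n
  inner_J : ∀ y z, ⟪J y, J z⟫ = ⟪y, z⟫
  J_e : ∀ y, ⟪J y, e⟫ = 0
  P_adj : ∀ x y, ⟪P x, y⟫ = ⟪x, J y⟫
  split : ∀ x, J (P x) + ⟪x, e⟫ • e = x
  Ω : Set (Eu n)
  hΩ : IsOpen Ω
  B : Set (Ep n)
  hB : IsOpen B
  bB : Bornology.IsBounded B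
  ψ : Ep n → Eu n
  ψ_mem : ∀ y ∈ B, ψ y ∈ M.carrier ∩ Ω
  P_ψ : ∀ y ∈ B, P (ψ y) = y
  P_mem : ∀ x ∈ M.carrier ∩ Ω, P x ∈ B
  ψ_P : ∀ x ∈ M.carrier ∩ Ω, ψ (P x) = x
  ψ_diff : ∀ y ∈ B, ContDiffAt ℝ 1 ψ y
  w_pos : ∀ x ∈ Ω, 1 / 2 < ⟪M.nu x, e⟫
  ψ_tan : ∀ y ∈ B, ∀ v, ⟪M.nu (ψ y), fderiv ℝ ψ y v⟫ = 0
  closedM : ∃ f : Eu n → ℝ, Continuous f ∧ M.carrier ∩ Ω = {y ∈ Ω | f y = 0}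

lemma exists_frame (e : Eu n) (he : ‖e‖ = 1) :
    ∃ (J : Ep n →L[ℝ] Eu n) (P : Eu n →L[ℝ] Ep n), (∀ y z, ⟪J y, J z⟫ = ⟪y, z⟫) ∧
      (∀ y, ⟪J y, e⟫ = 0) ∧ (∀ x y, ⟪P x, y⟫ = ⟪x, J y⟫) ∧
      (∀ x, J (P x) + ⟪x, e⟫ • e = x) := by
  have e0 : e ≠ 0 := by rintro rfl; simp at he
  have : Fact (Module.finrank ℝ (Eu n) = n + 1) := ⟨by simp⟩
  let b := OrthonormalBasis.fromOrthogonalSpanSingleton (𝕜 := ℝ) n e0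
  let J : Ep n →ₗᵢ[ℝ] Eu n := (ℝ ∙ e)ᗮ.subtypeₗᵢ.comp b.repr.symm.toLinearIsometry
  have hJe : ∀ y, ⟪J y, e⟫ = 0 := fun y => by
    have : (b.repr.symm y : Eu n) ∈ (ℝ ∙ e)ᗮ := (b.repr.symm y).2
    rw [Submodule.mem_orthogonal_singleton_iff_inner_left] at this
    exact this
  have hadj : ∀ x y, ⟪(ContinuousLinearMap.adjoint J.toContinuousLinearMap) x, y⟫ = ⟪x, J y⟫ :=
    fun x y => ContinuousLinearMap.adjoint_inner_left _ _ _
  refine ⟨J.toContinuousLinearMap, ContinuousLinearMap.adjoint J.toContinuousLinearMap,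
    fun y z => J.inner_map_map y z, hJe, hadj, fun x => ?_⟩
  set P := ContinuousLinearMap.adjoint J.toContinuousLinearMap
  -- x - ⟪x,e⟫ e is in the range of J
  have hx : x - ⟪x, e⟫ • e ∈ (ℝ ∙ e)ᗮ := by
    rw [Submodule.mem_orthogonal_singleton_iff_inner_left, inner_sub_left, real_inner_smul_left,
      real_inner_self_eq_norm_sq, he]; ring
  obtain ⟨z, hz⟩ : ∃ z, J z = x - ⟪x, e⟫ • e :=
    ⟨b.repr ⟨_, hx⟩, by simp [J]⟩
  have hPz : P x = z := by
    refine ext_inner_right ℝ fun y => ?_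
    rw [hadj, ← J.inner_map_map z y, hz, inner_sub_left, real_inner_smul_left, real_inner_comm _ e, hJe y]
    simp
  change J (P x) + _ = x
  rw [hPz, hz]; abel

lemma contDiff_nu (M : Hypersurface n) (k : ℕ) : ContDiff ℝ k M.nu :=
  M.smooth_nu.of_le (by exact_mod_cast le_top)

lemma exists_chart (M : Hypersurface n) (ξ : Eu n) (hξ : ξ ∈ M.carrier) :
    ∃ c : Chart M, ξ ∈ c.Ω ∧ c.e = M.nu ξ := by
  obtain ⟨U, hU, hξU, f, hf, hMU, hgrad, hnu⟩ := M.locally_level_set ξ hξ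
  set e := M.nu ξ with he_def
  have he : ‖e‖ = 1 := M.unit_nu ξ hξ
  obtain ⟨J, P, hJJ, hJe, hPJ, hsp⟩ := exists_frame e he
  have hf1 : ContDiff ℝ 1 f := hf.of_le (by exact_mod_cast le_top)
  have hdf : ∀ x v, fderiv ℝ f x v = ⟪gradient f x, v⟫ := fun x v => by
    simp [gradient]
  have hPe : P e = 0 := by
    refine ext_inner_right ℝ fun y => ?_
    rw [hPJ, real_inner_comm, hJe]; simp
  have hPJy : ∀ y, P (J y) = y := fun y => by
    refine ext_inner_right ℝ fun z => ?_
    rw [hPJ, hJJ]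
  have hgξ : gradient f ξ = ‖gradient f ξ‖ • e := by
    have := hnu ξ ⟨hξ, hξU⟩
    rw [he_def, this, smul_smul, mul_inv_cancel₀ (norm_ne_zero_iff.2 (hgrad ξ hξU)), one_smul]
  set g0 := ‖gradient f ξ‖ with hg0
  have hg0p : 0 < g0 := norm_pos_iff.2 (hgrad ξ hξU)
  let Φ : Eu n → Ep n × ℝ := fun x => (P x, f x)
  have hΦ : ContDiff ℝ 1 Φ := P.contDiff.prodMk hf1
  let A : Eu n ≃L[ℝ] Ep n × ℝ :=
    ContinuousLinearEquiv.equivOfInverse (P.prod (fderiv ℝ f ξ))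
      ((J.comp (ContinuousLinearMap.fst ℝ _ _)) +
        (ContinuousLinearMap.snd ℝ (Ep n) ℝ).smulRight (g0⁻¹ • e))
      (by
        intro x
        simp only [ContinuousLinearMap.prod_apply, add_apply,
          ContinuousLinearMap.comp_apply, ContinuousLinearMap.coe_fst', ContinuousLinearMap.smulRight_apply,
          ContinuousLinearMap.coe_snd']
        rw [hdf, hgξ, real_inner_smul_left, smul_smul]
        rw [show g0 * ⟪e, x⟫ * g0⁻¹ = ⟪x, e⟫ by rw [real_inner_comm]; field_simp]
        exact hsp x)
      (by
        rintro ⟨y, t⟩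
        simp only [ContinuousLinearMap.prod_apply, add_apply,
          ContinuousLinearMap.comp_apply, ContinuousLinearMap.coe_fst', ContinuousLinearMap.smulRight_apply,
          ContinuousLinearMap.coe_snd', map_add, map_smul, hPe, hPJy]
        rw [hdf, hdf, hgξ, real_inner_smul_left, real_inner_smul_left, real_inner_comm, hJe,
          real_inner_self_eq_norm_sq, he]
        ext1
        · simp
        · simp; field_simp)
  have hA : HasFDerivAt Φ (A : Eu n →L[ℝ] Ep n × ℝ) ξ :=
    P.hasFDerivAt.prodMk (hf1.differentiable (by simp) ξ).hasFDerivAt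
  let H := (hΦ.contDiffAt (x := ξ)).toOpenPartialHomeomorph Φ hA (by simp)
  have Hcoe : ∀ x, H x = Φ x := fun x => rfl
  have hξs : ξ ∈ H.source := (hΦ.contDiffAt (x := ξ)).mem_toOpenPartialHomeomorph_source hA (by simp)
  have hsymm : ContDiffAt ℝ 1 H.symm (Φ ξ) := (hΦ.contDiffAt (x := ξ)).to_localInverse hA (by simp)
  have hfξ : f ξ = 0 := by
    have : ξ ∈ M.carrier ∩ U := ⟨hξ, hξU⟩
    rw [hMU] at this; exact this.2
  have hΦξ : Φ ξ = (P ξ, 0) := by simp [Φ, hfξ]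
  have hev1 : ∀ᶠ z in 𝓝 (P ξ, (0 : ℝ)), ContDiffAt ℝ 1 H.symm z := by
    rw [← hΦξ]; exact hsymm.eventually (by simp)
  -- good open set
  let W : Set (Eu n) := U ∩ {x | 1 / 2 < ⟪M.nu x, e⟫}
  have hW : IsOpen W := hU.inter (isOpen_lt continuous_const
    ((contDiff_nu M 0).continuous.inner continuous_const))
  have hξW : ξ ∈ W := ⟨hξU, by
    change 1 / 2 < ⟪e, e⟫
    rw [real_inner_self_eq_norm_sq, he]; norm_num⟩
  have hΦξt : (P ξ, (0 : ℝ)) ∈ H.target := by rw [← hΦξ]; exact H.map_source hξs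
  have hξ' : H.symm (P ξ, 0) = ξ := by rw [← hΦξ]; exact H.left_inv hξs
  have hev2 : ∀ᶠ z in 𝓝 (P ξ, (0 : ℝ)), z ∈ H.target ∧ H.symm z ∈ W := by
    refine Filter.Eventually.and (H.open_target.mem_nhds hΦξt) ?_
    have : ContinuousAt H.symm (P ξ, 0) := H.continuousAt_symm hΦξt
    exact this.eventually (hW.mem_nhds (by rw [hξ']; exact hξW))
  obtain ⟨δ, hδ, hball⟩ := Metric.eventually_nhds_iff_ball.1 (hev1.and hev2)
  have hball' : ∀ y ∈ Metric.ball (P ξ) δ, ∀ t ∈ Metric.ball (0 : ℝ) δ,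
      ContDiffAt ℝ 1 H.symm (y, t) ∧ (y, t) ∈ H.target ∧ H.symm (y, t) ∈ W := by
    intro y hy t ht
    refine hball _ ?_
    rw [← ball_prod_same]; exact ⟨hy, ht⟩
  let Ω : Set (Eu n) := (H.source ∩ W) ∩ Φ ⁻¹' (Metric.ball (P ξ) δ ×ˢ Metric.ball 0 δ)
  have hΩ : IsOpen Ω := (H.open_source.inter hW).inter
    ((Metric.isOpen_ball.prod Metric.isOpen_ball).preimage hΦ.continuous)
  have hMΩ : M.carrier ∩ Ω = {y ∈ Ω | f y = 0} := by
    ext x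
    constructor
    · rintro ⟨h1, h2⟩
      have : x ∈ M.carrier ∩ U := ⟨h1, h2.1.2.1⟩
      rw [hMU] at this; exact ⟨h2, this.2⟩
    · rintro ⟨h1, h2⟩
      have : x ∈ {y ∈ U | f y = 0} := ⟨h1.1.2.1, h2⟩
      rw [← hMU] at this; exact ⟨this.1, h1⟩
  let ψ : Ep n → Eu n := fun y => H.symm (y, 0)
  have hψ1 : ∀ y ∈ Metric.ball (P ξ) δ, Φ (ψ y) = (y, 0) := fun y hy =>
    H.right_inv (hball' y hy 0 (Metric.mem_ball_self hδ)).2.1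
  have hψmem : ∀ y ∈ Metric.ball (P ξ) δ, ψ y ∈ M.carrier ∩ Ω := by
    intro y hy
    have h3 := hball' y hy 0 (Metric.mem_ball_self hδ)
    rw [hMΩ]
    have := hψ1 y hy
    refine ⟨⟨⟨H.map_target h3.2.1, h3.2.2⟩, ?_⟩, (Prod.mk.inj this).2⟩
    rw [mem_preimage, this]
    exact ⟨hy, Metric.mem_ball_self hδ⟩
  have hψd : ∀ y ∈ Metric.ball (P ξ) δ, ContDiffAt ℝ 1 ψ y := by
    intro y hy
    have h3 := (hball' y hy 0 (Metric.mem_ball_self hδ)).1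
    exact h3.comp (f := fun y : Ep n => (y, (0 : ℝ))) y (contDiff_id.prodMk contDiff_const).contDiffAt
  refine ⟨⟨e, he, J, P, hJJ, hJe, hPJ, hsp, Ω, hΩ, Metric.ball (P ξ) δ, Metric.isOpen_ball,
    Metric.isBounded_ball, ψ, hψmem, fun y hy => (Prod.mk.inj (hψ1 y hy)).1, ?_, ?_, hψd,
    fun x hx => hx.1.2.2, ?_, f, hf.continuous, hMΩ⟩, ?_, rfl⟩
  · exact fun x hx => hx.2.2.1
  · intro x hx
    have hx' := hx
    rw [hMΩ] at hx'
    have : Φ x = (P x, 0) := by simp [Φ, hx'.2]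
    change H.symm (P x, 0) = x
    rw [← this]; exact H.left_inv hx.2.1.1
  · intro y hy v
    have hz : HasFDerivAt (fun z => f (ψ z)) ((fderiv ℝ f (ψ y)).comp (fderiv ℝ ψ y)) y :=
      (hf1.differentiable (by simp) _).hasFDerivAt.comp y
        ((hψd y hy).differentiableAt (by simp)).hasFDerivAt
    have h0 : HasFDerivAt (fun z => f (ψ z)) (0 : Ep n →L[ℝ] ℝ) y := by
      refine (hasFDerivAt_const (0 : ℝ) y).congr_of_eventuallyEq ?_
      filter_upwards [Metric.isOpen_ball.mem_nhds hy] with z hz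
      exact (Prod.mk.inj (hψ1 z hz)).2
    have := congrArg (fun T => T v) (hz.unique h0)
    simp only [ContinuousLinearMap.comp_apply, zero_apply] at this
    rw [hdf] at this
    have hm := hψmem y hy
    rw [hnu (ψ y) ⟨hm.1, hm.2.1.2.1⟩, real_inner_smul_left, this, mul_zero]
  · refine ⟨⟨hξs, hξW⟩, ?_⟩
    rw [mem_preimage, hΦξ]
    exact ⟨Metric.mem_ball_self hδ, Metric.mem_ball_self hδ⟩

end MSA

namespace MSA
open Set Filter Topology
open scoped ENNReal NNReal

lemma measurable_carrier (M : Hypersurface n) : MeasurableSet M.carrier := by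
  have : IsLocallyClosed M.carrier := by
    refine ((isLocallyClosed_tfae M.carrier).out 0 3).2 fun x hx => ?_
    obtain ⟨c, hxc, -⟩ := exists_chart M x hx
    obtain ⟨f, hf, hM⟩ := c.closedM
    refine ⟨c.Ω, hxc, c.hΩ, ?_⟩
    rintro y ⟨hy, hyc⟩
    have h1 : y ∈ closure (c.Ω ∩ M.carrier) := c.hΩ.inter_closure ⟨hy, hyc⟩
    have h2 : c.Ω ∩ M.carrier ⊆ {y | f y = 0} := by
      rw [inter_comm, hM]; exact fun z hz => hz.2
    have h3 : f y = 0 := closure_minimal h2 (isClosed_eq hf continuous_const) h1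
    have : y ∈ M.carrier ∩ c.Ω := by rw [hM]; exact ⟨hy, h3⟩
    exact this.1
  obtain ⟨U, Z, hU, hZ, h⟩ := this
  rw [h]; exact hU.measurableSet.inter hZ.measurableSet

namespace Chart
variable {M : Hypersurface n} (c : Chart M)

/-- vertical component of the normal -/
def w (x : Eu n) : ℝ := ⟪M.nu x, c.e⟫

lemma w_pos' {x : Eu n} (hx : x ∈ c.Ω) : 0 < c.w x := lt_trans (by norm_num) (c.w_pos x hx)

lemma continuous_w : Continuous c.w := (contDiff_nu M 0).continuous.inner continuous_const

lemma P_e : c.P c.e = 0 := by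
  refine ext_inner_right ℝ fun y => ?_
  rw [c.P_adj, real_inner_comm, c.J_e]; simp

lemma P_J (y : Ep n) : c.P (c.J y) = y := by
  refine ext_inner_right ℝ fun z => ?_
  rw [c.P_adj, c.inner_J]

lemma norm_J (y : Ep n) : ‖c.J y‖ = ‖y‖ := by
  rw [← sq_eq_sq₀ (norm_nonneg _) (norm_nonneg _), ← real_inner_self_eq_norm_sq,
    ← real_inner_self_eq_norm_sq, c.inner_J]

lemma norm_sq_split (x : Eu n) : ‖x‖ ^ 2 = ‖c.P x‖ ^ 2 + ⟪x, c.e⟫ ^ 2 := by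
  have h := c.split x
  calc ‖x‖ ^ 2 = ⟪x, x⟫ := (real_inner_self_eq_norm_sq x).symm
    _ = ⟪x, c.J (c.P x) + ⟪x, c.e⟫ • c.e⟫ := by rw [h]
    _ = ‖c.P x‖ ^ 2 + ⟪x, c.e⟫ ^ 2 := by
      rw [inner_add_right, ← c.P_adj, real_inner_self_eq_norm_sq, real_inner_smul_right]; ring

lemma norm_P_le (x : Eu n) : ‖c.P x‖ ≤ ‖x‖ := by
  have := c.norm_sq_split x
  exact abs_le_of_sq_le_sq' (by nlinarith [sq_nonneg ⟪x, c.e⟫]) (norm_nonneg _) |>.2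

/-- slope of the graph -/
def a (y : Ep n) : Ep n := -(c.w (c.ψ y))⁻¹ • c.P (M.nu (c.ψ y))

lemma P_fderiv {y : Ep n} (hy : y ∈ c.B) (v : Ep n) : c.P (fderiv ℝ c.ψ y v) = v := by
  have h1 : HasFDerivAt (fun z => c.P (c.ψ z)) (c.P.comp (fderiv ℝ c.ψ y)) y :=
    c.P.hasFDerivAt.comp y ((c.ψ_diff y hy).differentiableAt (by simp)).hasFDerivAt
  have h2 : HasFDerivAt (fun z => c.P (c.ψ z)) (ContinuousLinearMap.id ℝ (Ep n)) y := by
    refine (hasFDerivAt_id y).congr_of_eventuallyEq ?_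
    filter_upwards [c.hB.mem_nhds hy] with z hz
    exact c.P_ψ z hz
  exact congrArg (fun T => T v) (h1.unique h2)

lemma fderiv_ψ {y : Ep n} (hy : y ∈ c.B) (v : Ep n) :
    fderiv ℝ c.ψ y v = c.J v + ⟪c.a y, v⟫ • c.e := by
  have h1 := c.split (fderiv ℝ c.ψ y v)
  rw [c.P_fderiv hy] at h1
  have h2 := c.ψ_tan y hy v
  have hw := c.w_pos' (c.ψ_mem y hy).2
  rw [← h1, inner_add_right, real_inner_smul_right, ← c.P_adj] at h2
  change _ + _ * c.w (c.ψ y) = 0 at h2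
  rw [← h1]
  congr 2
  rw [a, real_inner_smul_left]
  field_simp
  linarith

lemma norm_a {y : Ep n} (hy : y ∈ c.B) : 1 + ‖c.a y‖ ^ 2 = ((c.w (c.ψ y))⁻¹) ^ 2 := by
  have hw := c.w_pos' (c.ψ_mem y hy).2
  have h1 := c.norm_sq_split (M.nu (c.ψ y))
  rw [M.unit_nu _ (c.ψ_mem y hy).1] at h1
  change _ = _ + c.w (c.ψ y) ^ 2 at h1
  rw [a, norm_smul, mul_pow, Real.norm_eq_abs, sq_abs]
  field_simp
  linarith

lemma normDet_fderiv {y : Ep n} (hy : y ∈ c.B) :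
    (fderiv ℝ c.ψ y).toLinearMap.normDet = (c.w (c.ψ y))⁻¹ := by
  have hw := c.w_pos' (c.ψ_mem y hy).2
  rw [← sq_eq_sq₀ (LinearMap.normDet_nonneg _) (inv_nonneg.2 hw.le), ← c.norm_a hy]
  have h := LinearMap.normDet_sq (𝕜 := ℝ) (fderiv ℝ c.ψ y).toLinearMap
  have h2 : LinearMap.adjoint (fderiv ℝ c.ψ y).toLinearMap ∘ₗ (fderiv ℝ c.ψ y).toLinearMap
      = LinearMap.transvection (innerSL ℝ (c.a y)).toLinearMap (c.a y) := by
    ext1 v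
    refine ext_inner_right ℝ fun u => ?_
    simp only [LinearMap.comp_apply, LinearMap.adjoint_inner_left, LinearMap.transvection.apply,
      ContinuousLinearMap.coe_coe, innerSL_apply_apply]
    rw [c.fderiv_ψ hy, c.fderiv_ψ hy]
    simp only [inner_add_left, inner_add_right, real_inner_smul_left, real_inner_smul_right, c.inner_J,
      c.J_e, real_inner_self_eq_norm_sq c.e, c.he, real_inner_comm _ c.e]
    simp [mul_comm]
  rw [h2, LinearMap.transvection.det] at h
  simp only [RCLike.ofReal_real_eq_id, id] at h
  rw [h]
  simp

end Chart
end MSA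

namespace MSA
open Set Filter Topology
open scoped ENNReal NNReal

lemma measure_le_of_local {X : Type*} [TopologicalSpace X] [SecondCountableTopology X]
    [MeasurableSpace X] [OpensMeasurableSpace X] (μ ν : Measure X) (B : Set X) (hμ : μ Bᶜ = 0)
    (h : ∀ y ∈ B, ∃ O, IsOpen O ∧ y ∈ O ∧ ∀ A ⊆ O, MeasurableSet A → μ A ≤ ν A) : μ ≤ ν := by
  choose! O hO hyO hA using h
  rw [Measure.le_iff]
  intro A hAm
  obtain ⟨t, htB, htc, hcov⟩ := TopologicalSpace.countable_cover_nhdsWithin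
    (s := B) (f := O) (fun y hy => mem_nhdsWithin_of_mem_nhds ((hO y hy).mem_nhds (hyO y hy)))
  rcases t.eq_empty_or_nonempty with rfl | hne
  · have : B = ∅ := by simpa using hcov
    subst this
    have : μ A = 0 := measure_mono_null (subset_univ _) (by simpa using hμ)
    simp [this]
  obtain ⟨g, hg⟩ := htc.exists_eq_range hne
  have hgB : ∀ i, g i ∈ B := fun i => htB (by rw [hg]; exact mem_range_self i)
  let D : ℕ → Set X := disjointed fun i => O (g i)
  have hDm : ∀ i, MeasurableSet (D i) := fun i =>
    MeasurableSet.disjointed (fun i => (hO _ (hgB i)).measurableSet) i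
  have hDd : Pairwise (Function.onFun Disjoint D) := disjoint_disjointed _
  have hU : B ⊆ ⋃ i, D i := by
    rw [iUnion_disjointed]
    refine hcov.trans ?_
    rw [hg]; simp
  have hdd : Pairwise (Function.onFun Disjoint fun i => A ∩ D i) := fun i j hij =>
    (hDd hij).mono inter_subset_right inter_subset_right
  calc μ A ≤ μ ((⋃ i, A ∩ D i) ∪ Bᶜ) := by
        refine measure_mono fun x hx => ?_
        by_cases hxB : x ∈ B
        · left; rw [← inter_iUnion]; exact ⟨hx, hU hxB⟩
        · right; exact hxB
    _ ≤ μ (⋃ i, A ∩ D i) + μ Bᶜ := measure_union_le _ _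
    _ = ∑' i, μ (A ∩ D i) := by
        rw [hμ, add_zero, measure_iUnion hdd (fun i => hAm.inter (hDm i))]
    _ ≤ ∑' i, ν (A ∩ D i) := ENNReal.tsum_le_tsum fun i =>
        hA (g i) (hgB i) _ (inter_subset_right.trans (disjointed_le _ i)) (hAm.inter (hDm i))
    _ = ν (⋃ i, A ∩ D i) := (measure_iUnion hdd (fun i => hAm.inter (hDm i))).symm
    _ ≤ ν A := measure_mono (iUnion_subset fun i => inter_subset_left)

lemma le_of_forall_factor {x y : ℝ≥0∞} (k : ℕ) (h : ∀ q : ℝ≥0, 1 < q → x ≤ (q : ℝ≥0∞) ^ k * y) :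
    x ≤ y := by
  have h1 : Tendsto (fun q : ℝ≥0 => ((q : ℝ≥0∞) ^ k) * y) (𝓝[>] 1) (𝓝 (1 * y)) := by
    refine ENNReal.Tendsto.mul_const ?_ (Or.inl one_ne_zero)
    have : Tendsto (fun q : ℝ≥0 => ((q ^ k : ℝ≥0) : ℝ≥0∞)) (𝓝[>] 1) (𝓝 ((1 ^ k : ℝ≥0) : ℝ≥0∞)) := by
      rw [ENNReal.tendsto_coe]
      exact ((continuous_pow k).tendsto 1).mono_left nhdsWithin_le_nhds
    simpa using this
  rw [one_mul] at h1
  refine ge_of_tendsto h1 ?_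
  filter_upwards [self_mem_nhdsWithin] with q hq using h q hq

namespace Chart
variable {M : Hypersurface n} (c : Chart M)

lemma preimage_eq (A : Set (Ep n)) :
    c.P ⁻¹' A ∩ (M.carrier ∩ c.Ω) = c.ψ '' (A ∩ c.B) := by
  ext x
  constructor
  · rintro ⟨h1, h2⟩
    exact ⟨c.P x, ⟨h1, c.P_mem x h2⟩, c.ψ_P x h2⟩
  · rintro ⟨y, ⟨hyA, hyB⟩, rfl⟩
    exact ⟨by rw [mem_preimage, c.P_ψ y hyB]; exact hyA, c.ψ_mem y hyB⟩

/-- local comparison -/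
lemma local_compare {y : Ep n} (hy : y ∈ c.B) (q : ℝ≥0) (hq : 1 < q) :
    ∃ O, IsOpen O ∧ y ∈ O ∧ O ⊆ c.B ∧
      (∀ A ⊆ O, μH[(n : ℝ)] (c.ψ '' A) ≤ (q : ℝ≥0∞) ^ n * (ENNReal.ofReal (c.w (c.ψ y))⁻¹ * μH[(n : ℝ)] A)) ∧
      (∀ A ⊆ O, (ENNReal.ofReal (c.w (c.ψ y))⁻¹ * μH[(n : ℝ)] A) ≤ (q : ℝ≥0∞) ^ n * μH[(n : ℝ)] (c.ψ '' A)) ∧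
      (∀ z ∈ O, ENNReal.ofReal (c.w (c.ψ z))⁻¹ ≤ q * ENNReal.ofReal (c.w (c.ψ y))⁻¹) ∧
      (∀ z ∈ O, ENNReal.ofReal (c.w (c.ψ y))⁻¹ ≤ q * ENNReal.ofReal (c.w (c.ψ z))⁻¹) := by
  have hq' : (1 : ℝ) < q := hq
  set η : ℝ := q - 1 with hη
  have hηp : 0 < η := by linarith
  set Lc := fderiv ℝ c.ψ y with hL
  have hstrict : HasStrictFDerivAt c.ψ Lc y := (c.ψ_diff y hy).hasStrictFDerivAt (by simp)
  obtain ⟨s, hs, happ⟩ := hstrict.approximates_deriv_on_nhds (c := ⟨η, hηp.le⟩) (Or.inr hηp)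
  have hwpos := c.w_pos' (c.ψ_mem y hy).2
  have hcont : ContinuousAt (fun z => (c.w (c.ψ z))⁻¹) y :=
    (c.continuous_w.continuousAt.comp (c.ψ_diff y hy).continuousAt).inv₀ hwpos.ne'
  set W := (c.w (c.ψ y))⁻¹ with hW
  have hWp : 0 < W := inv_pos.2 hwpos
  have e1 : ∀ᶠ z in 𝓝 y, (c.w (c.ψ z))⁻¹ < q * W := hcont.eventually_lt_const (by nlinarith)
  have e2 : ∀ᶠ z in 𝓝 y, W / q < (c.w (c.ψ z))⁻¹ :=
    hcont.eventually_const_lt (by rw [div_lt_iff₀ (by linarith)]; nlinarith)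
  have e3 : ∀ᶠ z in 𝓝 y, z ∈ s ∧ z ∈ c.B := Filter.Eventually.and hs (c.hB.mem_nhds hy)
  obtain ⟨O, hOs, hO, hyO⟩ := eventually_nhds_iff.1 (e1.and (e2.and e3))
  have hqc : (q : ℝ≥0∞) ^ (n : ℝ) = (q : ℝ≥0∞) ^ n := ENNReal.rpow_natCast _ _
  have hLA : ∀ A : Set (Ep n), μH[(n : ℝ)] (Lc '' A) = ENNReal.ofReal W * μH[(n : ℝ)] A := by
    intro A
    have := LinearMap.hausdorffMeasure_image Lc.toLinearMap A
    rw [c.normDet_fderiv hy] at this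
    simpa using this
  have hPL : ∀ v, c.P (Lc v) = v := fun v => c.P_fderiv hy v
  have hLn : ∀ v, ‖v‖ ≤ ‖Lc v‖ := fun v => by
    conv_lhs => rw [← hPL v]
    exact c.norm_P_le _
  have key : ∀ u ∈ O, ∀ v ∈ O, ‖c.ψ u - c.ψ v - Lc (u - v)‖ ≤ η * ‖u - v‖ := fun u hu v hv =>
    happ u (hOs u hu).2.2.1 v (hOs v hv).2.2.1
  have k1 : ∀ u ∈ O, ∀ v ∈ O, ‖c.ψ u - c.ψ v‖ ≤ q * ‖Lc u - Lc v‖ := by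
    intro u hu v hv
    have h1 := key u hu v hv
    have h2 := hLn (u - v)
    have h3 := norm_sub_norm_le (c.ψ u - c.ψ v) (Lc (u - v))
    rw [← map_sub]
    nlinarith
  have k2 : ∀ u ∈ O, ∀ v ∈ O, ‖Lc u - Lc v‖ ≤ q * ‖c.ψ u - c.ψ v‖ := by
    intro u hu v hv
    have h1 := key u hu v hv
    have h2 : ‖u - v‖ ≤ ‖c.ψ u - c.ψ v‖ := by
      have := c.norm_P_le (c.ψ u - c.ψ v)
      rwa [map_sub, c.P_ψ u (hOs u hu).2.2.2, c.P_ψ v (hOs v hv).2.2.2] at this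
    have h3 := norm_sub_norm_le (Lc (u - v)) (c.ψ u - c.ψ v)
    rw [norm_sub_rev (Lc (u - v))] at h3
    rw [← map_sub]
    nlinarith
  refine ⟨O, hO, hyO, fun z hz => (hOs z hz).2.2.2, ?_, ?_, ?_, ?_⟩
  · intro A hA
    have hlip : LipschitzOnWith q (fun x => c.ψ (c.P x)) (Lc '' A) := by
      refine LipschitzOnWith.of_dist_le_mul ?_
      rintro _ ⟨u, hu, rfl⟩ _ ⟨v, hv, rfl⟩
      rw [hPL, hPL, dist_eq_norm, dist_eq_norm]
      exact k1 u (hA hu) v (hA hv)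
    have := hlip.hausdorffMeasure_image_le (d := (n : ℝ)) (by positivity)
    rw [hLA, hqc, image_image] at this
    simpa only [hPL] using this
  · intro A hA
    have hlip : LipschitzOnWith q (fun x => Lc (c.P x)) (c.ψ '' A) := by
      refine LipschitzOnWith.of_dist_le_mul ?_
      rintro _ ⟨u, hu, rfl⟩ _ ⟨v, hv, rfl⟩
      rw [c.P_ψ u (hOs u (hA hu)).2.2.2, c.P_ψ v (hOs v (hA hv)).2.2.2, dist_eq_norm, dist_eq_norm]
      exact k2 u (hA hu) v (hA hv)
    have := hlip.hausdorffMeasure_image_le (d := (n : ℝ)) (by positivity)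
    rw [hqc, image_image] at this
    rw [← hLA]
    convert this using 2
    refine image_congr fun u hu => ?_
    rw [c.P_ψ u (hOs u (hA hu)).2.2.2]
  · intro z hz
    rw [← ENNReal.ofReal_coe_nnreal, ← ENNReal.ofReal_mul (by positivity)]
    exact ENNReal.ofReal_le_ofReal (hOs z hz).1.le
  · intro z hz
    rw [← ENNReal.ofReal_coe_nnreal, ← ENNReal.ofReal_mul (by positivity)]
    refine ENNReal.ofReal_le_ofReal ?_
    have := (hOs z hz).2.1
    rw [div_lt_iff₀ (by linarith)] at this
    linarith

/-- area formula in a chart -/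
theorem area :
    ((μH[(n : ℝ)] : Measure (Eu n)).restrict (M.carrier ∩ c.Ω)).map c.P =
      ((μH[(n : ℝ)] : Measure (Ep n)).restrict c.B).withDensity
        (fun y => ENNReal.ofReal (c.w (c.ψ y))⁻¹) := by
  have hP : Measurable c.P := c.P.continuous.measurable
  set μ₁ := ((μH[(n : ℝ)] : Measure (Eu n)).restrict (M.carrier ∩ c.Ω)).map c.P with hμ₁
  set μ₂ := ((μH[(n : ℝ)] : Measure (Ep n)).restrict c.B).withDensity
        (fun y => ENNReal.ofReal (c.w (c.ψ y))⁻¹) with hμ₂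
  have v1 : ∀ A, MeasurableSet A → μ₁ A = μH[(n : ℝ)] (c.ψ '' (A ∩ c.B)) := by
    intro A hA
    rw [hμ₁, Measure.map_apply hP hA, Measure.restrict_apply (hP hA), c.preimage_eq]
  have v2 : ∀ A, MeasurableSet A → μ₂ A = ∫⁻ y in A ∩ c.B, ENNReal.ofReal (c.w (c.ψ y))⁻¹ ∂μH[(n : ℝ)] := by
    intro A hA
    rw [hμ₂, withDensity_apply _ hA, Measure.restrict_restrict hA]
  have hBm : MeasurableSet c.Bᶜ := c.hB.measurableSet.compl
  have z1 : μ₁ c.Bᶜ = 0 := by rw [v1 _ hBm]; simp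
  have z2 : μ₂ c.Bᶜ = 0 := by rw [v2 _ hBm]; simp
  apply le_antisymm
  · rw [Measure.le_iff]
    intro A hA
    refine le_of_forall_factor (n + 1) fun q hq => ?_
    suffices h : μ₁ ≤ ((q : ℝ≥0∞) ^ (n + 1)) • μ₂ from h A
    refine measure_le_of_local _ _ c.B z1 fun y hy => ?_
    obtain ⟨O, hO, hyO, hOB, h1, h2, h3, h4⟩ := c.local_compare hy q hq
    refine ⟨O, hO, hyO, fun A hAO hA => ?_⟩
    rw [Measure.smul_apply, smul_eq_mul, v1 A hA, v2 A hA, inter_eq_left.2 (hAO.trans hOB)]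
    refine (h1 A hAO).trans ?_
    rw [pow_succ, mul_assoc]
    refine mul_le_mul_right ?_ _
    rw [← lintegral_const_mul' _ _ ENNReal.coe_ne_top, ← setLIntegral_const]
    exact setLIntegral_mono' hA fun z hz => h4 z (hAO hz)
  · rw [Measure.le_iff]
    intro A hA
    refine le_of_forall_factor (n + 1) fun q hq => ?_
    suffices h : μ₂ ≤ ((q : ℝ≥0∞) ^ (n + 1)) • μ₁ from h A
    refine measure_le_of_local _ _ c.B z2 fun y hy => ?_
    obtain ⟨O, hO, hyO, hOB, h1, h2, h3, h4⟩ := c.local_compare hy q hq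
    refine ⟨O, hO, hyO, fun A hAO hA => ?_⟩
    rw [Measure.smul_apply, smul_eq_mul, v1 A hA, v2 A hA, inter_eq_left.2 (hAO.trans hOB)]
    calc ∫⁻ y in A, ENNReal.ofReal (c.w (c.ψ y))⁻¹ ∂μH[(n : ℝ)]
        ≤ ∫⁻ z in A, (q * ENNReal.ofReal (c.w (c.ψ y))⁻¹) ∂μH[(n : ℝ)] :=
          setLIntegral_mono' hA fun z hz => h3 z (hAO hz)
      _ = q * (ENNReal.ofReal (c.w (c.ψ y))⁻¹ * μH[(n : ℝ)] A) := by
          rw [setLIntegral_const, mul_assoc]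
      _ ≤ q * ((q : ℝ≥0∞) ^ n * μH[(n : ℝ)] (c.ψ '' A)) := mul_le_mul_right (h2 A hAO) _
      _ = _ := by rw [pow_succ]; ring

end Chart
end MSA

namespace MSA
open Set Filter Topology
open scoped ENNReal NNReal

lemma fderiv_coord {Z : Eu n → Eu n} {x : Eu n} (hZ : DifferentiableAt ℝ Z x) (i : Fin (n + 1))
    (v : Eu n) : fderiv ℝ (fun y => Z y i) x v = (fderiv ℝ Z x v) i := by
  have h : HasFDerivAt (fun y => Z y i)
      ((EuclideanSpace.proj i : Eu n →L[ℝ] ℝ).comp (fderiv ℝ Z x)) x :=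
    (EuclideanSpace.proj i : Eu n →L[ℝ] ℝ).hasFDerivAt.comp x hZ.hasFDerivAt
  rw [h.fderiv]; rfl

lemma sum_single (v : Eu n) : ∑ j, v j • (EuclideanSpace.single j (1 : ℝ) : Eu n) = v := by
  ext i
  simp [Finset.sum_apply, Pi.single_apply]

/-- trace -/
abbrev tr {E : Type*} [NormedAddCommGroup E] [NormedSpace ℝ E] (A : E →L[ℝ] E) : ℝ :=
  LinearMap.trace ℝ E A.toLinearMap

lemma tr_sum {k : ℕ} (A : EuclideanSpace ℝ (Fin k) →L[ℝ] EuclideanSpace ℝ (Fin k)) :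
    tr A = ∑ i, A (EuclideanSpace.single i 1) i := by
  rw [tr, LinearMap.trace_eq_sum_inner _ (EuclideanSpace.basisFun (Fin k) ℝ)]
  refine Finset.sum_congr rfl fun i _ => ?_
  simp [EuclideanSpace.inner_single_left]

lemma tdiv_eq (ν : Eu n → Eu n) {Z : Eu n → Eu n} {x : Eu n} (hZ : DifferentiableAt ℝ Z x) :
    tdiv ν Z x = tr (fderiv ℝ Z x) - ⟪fderiv ℝ Z x (ν x), ν x⟫ := by
  rw [tr_sum]
  simp only [tdiv, tderiv, Finset.sum_sub_distrib, fderiv_coord hZ]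
  congr 1
  have : fderiv ℝ Z x (ν x) = ∑ j, ν x j • fderiv ℝ Z x (EuclideanSpace.single j 1) := by
    conv_lhs => rw [← sum_single (ν x)]
    rw [map_sum]; simp
  rw [this, PiLp.inner_apply]
  refine Finset.sum_congr rfl fun i _ => ?_
  simp [Finset.sum_apply, mul_comm, Finset.mul_sum]

lemma tgrad_inner (ν : Eu n → Eu n) (u : Eu n → ℝ) (x v : Eu n) :
    ⟪tgrad ν u x, v⟫ = fderiv ℝ u x (v - ⟪v, ν x⟫ • ν x) := by
  have hdf : ∀ v, fderiv ℝ u x v = ⟪gradient u x, v⟫ := fun v => by simp [gradient]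
  rw [hdf, tgrad, inner_sub_left, inner_sub_right, real_inner_smul_left, real_inner_smul_right,
    real_inner_comm (ν x) v]
  ring

lemma fderiv_tangent_congr (M : Hypersurface n) {x : Eu n} (hx : x ∈ M.carrier) {E : Type*}
    [NormedAddCommGroup E] [NormedSpace ℝ E] {F G : Eu n → E} (hF : DifferentiableAt ℝ F x)
    (hG : DifferentiableAt ℝ G x) (h : F =ᶠ[𝓝[M.carrier] x] G) {t : Eu n} (ht : ⟪t, M.nu x⟫ = 0) :
    fderiv ℝ F x t = fderiv ℝ G x t := by
  obtain ⟨c, hxc, -⟩ := exists_chart M x hx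
  set y := c.P x with hy
  have hyB : y ∈ c.B := c.P_mem x ⟨hx, hxc⟩
  have hψ : c.ψ y = x := c.ψ_P x ⟨hx, hxc⟩
  have hd := (c.ψ_diff y hyB).differentiableAt (by simp)
  have hw := c.w_pos' hxc
  have htt : fderiv ℝ c.ψ y (c.P t) = t := by
    rw [c.fderiv_ψ hyB]
    have h1 := c.split t
    have h2 : ⟪c.a y, c.P t⟫ = ⟪t, c.e⟫ := by
      rw [Chart.a, hψ, real_inner_smul_left, c.P_adj]
      have : ⟪M.nu x, c.J (c.P t) + ⟪t, c.e⟫ • c.e⟫ = 0 := by rw [h1, real_inner_comm]; exact ht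
      rw [inner_add_right, real_inner_smul_right] at this
      change _ + _ * c.w x = 0 at this
      field_simp
      linarith
    rw [h2, h1]
  have key : (fun z => F (c.ψ z)) =ᶠ[𝓝 y] (fun z => G (c.ψ z)) := by
    have : Tendsto c.ψ (𝓝 y) (𝓝[M.carrier] x) := by
      refine tendsto_nhdsWithin_iff.2 ⟨by rw [← hψ]; exact hd.continuousAt, ?_⟩
      filter_upwards [c.hB.mem_nhds hyB] with z hz using (c.ψ_mem z hz).1
    exact this.eventually h
  rw [← hψ] at hF hG
  have hF' : HasFDerivAt (fun z => F (c.ψ z)) ((fderiv ℝ F (c.ψ y)).comp (fderiv ℝ c.ψ y)) y :=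
    hF.hasFDerivAt.comp y hd.hasFDerivAt
  have hG' : HasFDerivAt (fun z => G (c.ψ z)) ((fderiv ℝ G (c.ψ y)).comp (fderiv ℝ c.ψ y)) y :=
    hG.hasFDerivAt.comp y hd.hasFDerivAt
  have := congrArg (fun T => T (c.P t)) (hF'.unique (hG'.congr_of_eventuallyEq key))
  simpa [htt, hψ] using this

lemma diff_nu (M : Hypersurface n) (x : Eu n) : DifferentiableAt ℝ M.nu x :=
  (contDiff_nu M 1).differentiable (by simp) x

lemma nu_nu (M : Hypersurface n) {x : Eu n} (hx : x ∈ M.carrier) : ⟪M.nu x, M.nu x⟫ = 1 := by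
  rw [real_inner_self_eq_norm_sq, M.unit_nu x hx]; norm_num

lemma dnu_nu (M : Hypersurface n) {x : Eu n} (hx : x ∈ M.carrier) {t : Eu n}
    (ht : ⟪t, M.nu x⟫ = 0) : ⟪fderiv ℝ M.nu x t, M.nu x⟫ = 0 := by
  have h := fderiv_tangent_congr M hx (F := fun z => ⟪M.nu z, M.nu z⟫) (G := fun _ => (1 : ℝ))
    ((diff_nu M x).inner ℝ (diff_nu M x)) (differentiableAt_const _)
    (by filter_upwards [self_mem_nhdsWithin] with z hz using nu_nu M hz) ht
  rw [fderiv_inner_apply ℝ (diff_nu M x) (diff_nu M x)] at h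
  simp only [fderiv_fun_const, Pi.zero_apply, zero_apply] at h
  rw [real_inner_comm] at h
  linarith

lemma dY_nu (M : Hypersurface n) {x : Eu n} (hx : x ∈ M.carrier) {t : Eu n}
    (ht : ⟪t, M.nu x⟫ = 0) {Y : Eu n → Eu n} (hY : DifferentiableAt ℝ Y x)
    (hYt : ∀ z ∈ M.carrier, ⟪Y z, M.nu z⟫ = 0) :
    ⟪fderiv ℝ Y x t, M.nu x⟫ = - ⟪Y x, fderiv ℝ M.nu x t⟫ := by
  have h := fderiv_tangent_congr M hx (F := fun z => ⟪Y z, M.nu z⟫) (G := fun _ => (0 : ℝ))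
    (hY.inner ℝ (diff_nu M x)) (differentiableAt_const _)
    (by filter_upwards [self_mem_nhdsWithin] with z hz using hYt z hz) ht
  rw [fderiv_inner_apply ℝ hY (diff_nu M x)] at h
  simp only [fderiv_fun_const, Pi.zero_apply, zero_apply] at h
  linarith

lemma shape_symm (M : Hypersurface n) {x : Eu n} (hx : x ∈ M.carrier) {s t : Eu n}
    (hs : ⟪s, M.nu x⟫ = 0) (ht : ⟪t, M.nu x⟫ = 0) :
    ⟪fderiv ℝ M.nu x s, t⟫ = ⟪fderiv ℝ M.nu x t, s⟫ := by
  obtain ⟨U, hU, hxU, f, hf, hMU, hgrad, hnu⟩ := M.locally_level_set x hx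
  have hf2' : ContDiff ℝ ((2 : ℕ) : WithTop ℕ∞) f := contDiff_infty.1 hf 2
  have hf2 : ContDiff ℝ 2 f := hf2'
  have hdf : Differentiable ℝ (fderiv ℝ f) := (hf2.fderiv_right (m := 1) (by norm_num)).differentiable (by simp)
  let R : (Eu n →L[ℝ] ℝ) →L[ℝ] Eu n := (InnerProductSpace.toDual ℝ (Eu n)).symm.toContinuousLinearEquiv.toContinuousLinearMap
  have hR : ∀ (l : Eu n →L[ℝ] ℝ) v, ⟪R l, v⟫ = l v := fun l v => by simp [R]
  have hg : ∀ z, gradient f z = R (fderiv ℝ f z) := fun z => rfl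
  have hgd : HasFDerivAt (gradient f) (R.comp (fderiv ℝ (fderiv ℝ f) x)) x :=
    R.hasFDerivAt.comp x (hdf x).hasFDerivAt
  set g : Eu n → ℝ := fun z => ⟪gradient f z, M.nu z⟫ with hgdef
  have hgdiff : DifferentiableAt ℝ g x := hgd.differentiableAt.inner ℝ (diff_nu M x)
  have key : ∀ a b : Eu n, ⟪a, M.nu x⟫ = 0 → ⟪b, M.nu x⟫ = 0 →
      g x * ⟪fderiv ℝ M.nu x a, b⟫ = fderiv ℝ (fderiv ℝ f) x a b := by
    intro a b ha hb
    have h := fderiv_tangent_congr M hx (F := fun z => g z • M.nu z) (G := gradient f)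
      (hgdiff.smul (diff_nu M x)) hgd.differentiableAt (by
        filter_upwards [self_mem_nhdsWithin, mem_nhdsWithin_of_mem_nhds (hU.mem_nhds hxU)] with z hz hzU
        have h1 := hnu z ⟨hz, hzU⟩
        have h0 : ‖gradient f z‖ ≠ 0 := norm_ne_zero_iff.2 (hgrad z hzU)
        rw [hgdef]
        simp only
        rw [h1, real_inner_smul_right, real_inner_self_eq_norm_sq, smul_smul]
        rw [show ‖gradient f z‖⁻¹ * ‖gradient f z‖ ^ 2 * ‖gradient f z‖⁻¹ = 1 by field_simp, one_smul]) ha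
    rw [fderiv_fun_smul hgdiff (diff_nu M x), hgd.fderiv] at h
    have h2 := congrArg (fun v => ⟪v, b⟫) h
    simp only [add_apply, smul_apply, ContinuousLinearMap.smulRight_apply,
      ContinuousLinearMap.comp_apply, inner_add_left, real_inner_smul_left, hR] at h2
    rw [real_inner_comm, real_inner_comm] at h2
    rw [← h2]
    simp [hb, real_inner_comm]
  have hg0 : g x ≠ 0 := by
    have h0 : ‖gradient f x‖ ≠ 0 := norm_ne_zero_iff.2 (hgrad x hxU)
    simp only [hgdef]
    rw [hnu x ⟨hx, hxU⟩, real_inner_smul_right, real_inner_self_eq_norm_sq]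
    field_simp
    simpa using h0
  have hsym : IsSymmSndFDerivAt ℝ f x := hf2.contDiffAt.isSymmSndFDerivAt (by simp)
  have := hsym s t
  have k1 := key s t hs ht
  have k2 := key t s ht hs
  rw [← mul_right_inj' hg0, k1, k2, this]

end MSA

namespace MSA
open Set Filter Topology
open scoped ENNReal NNReal

namespace Chart
variable {M : Hypersurface n} (c : Chart M)

lemma fderiv_ψ_P {y : Ep n} (hy : y ∈ c.B) (v : Eu n) :
    fderiv ℝ c.ψ y (c.P v) = v - ((c.w (c.ψ y))⁻¹ * ⟪M.nu (c.ψ y), v⟫) • c.e := by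
  have hw := c.w_pos' (c.ψ_mem y hy).2
  rw [c.fderiv_ψ hy]
  have h1 := c.split v
  have h2 : ⟪c.a y, c.P v⟫ = ⟪v, c.e⟫ - (c.w (c.ψ y))⁻¹ * ⟪M.nu (c.ψ y), v⟫ := by
    rw [Chart.a, real_inner_smul_left, c.P_adj]
    have : ⟪M.nu (c.ψ y), c.J (c.P v) + ⟪v, c.e⟫ • c.e⟫ = ⟪M.nu (c.ψ y), v⟫ := by rw [h1]
    rw [inner_add_right, real_inner_smul_right] at this
    change _ + _ * c.w (c.ψ y) = _ at this
    field_simp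
    linarith
  rw [h2, sub_smul, ← add_sub_assoc, h1]

lemma tr_chart (A : Eu n →L[ℝ] Eu n) {y : Ep n} (hy : y ∈ c.B) :
    tr (c.P ∘L A ∘L fderiv ℝ c.ψ y) = tr A - (c.w (c.ψ y))⁻¹ * ⟪A c.e, M.nu (c.ψ y)⟫ := by
  have h1 : tr (c.P ∘L A ∘L fderiv ℝ c.ψ y) =
      LinearMap.trace ℝ (Eu n) ((A ∘L fderiv ℝ c.ψ y).toLinearMap ∘ₗ c.P.toLinearMap) := by
    rw [LinearMap.trace_comp_comm']
    rfl
  have h2 : (A ∘L fderiv ℝ c.ψ y).toLinearMap ∘ₗ c.P.toLinearMap =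
      A.toLinearMap - ((c.w (c.ψ y))⁻¹ • (innerSL ℝ (M.nu (c.ψ y))).toLinearMap).smulRight (A c.e) := by
    ext1 v
    simp [c.fderiv_ψ_P hy]
  rw [h1, h2, map_sub, LinearMap.trace_smulRight]
  simp [real_inner_comm]

/-- transported vector field -/
def fld (Y : Eu n → Eu n) (y : Ep n) : Ep n := c.P ((c.w (c.ψ y))⁻¹ • Y (c.ψ y))

lemma hasFDerivAt_fld {Y : Eu n → Eu n} {y : Ep n} (hy : y ∈ c.B)
    (hY : DifferentiableAt ℝ Y (c.ψ y)) : HasFDerivAt (c.fld Y) 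
      (c.P ∘L (fderiv ℝ (fun x => (c.w x)⁻¹ • Y x) (c.ψ y)) ∘L fderiv ℝ c.ψ y) y := by
  have hw := c.w_pos' (c.ψ_mem y hy).2
  have hwd : DifferentiableAt ℝ c.w (c.ψ y) := (diff_nu M _).inner ℝ (differentiableAt_const _)
  have hd := (c.ψ_diff y hy).differentiableAt (by simp)
  have h1 : DifferentiableAt ℝ (fun x => (c.w x)⁻¹ • Y x) (c.ψ y) := (hwd.inv hw.ne').smul hY
  exact c.P.hasFDerivAt.comp y (h1.hasFDerivAt.comp y hd.hasFDerivAt)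

lemma tr_fld {Y : Eu n → Eu n} {y : Ep n} (hy : y ∈ c.B)
    (hY : DifferentiableAt ℝ Y (c.ψ y)) (hYt : ∀ z ∈ M.carrier, ⟪Y z, M.nu z⟫ = 0) :
    tr (fderiv ℝ (c.fld Y) y) = (c.w (c.ψ y))⁻¹ * tdiv M.nu Y (c.ψ y) := by
  rw [(c.hasFDerivAt_fld hy hY).fderiv, c.tr_chart _ hy, tdiv_eq _ hY]
  have hx := (c.ψ_mem y hy).1
  have hw := c.w_pos' (c.ψ_mem y hy).2
  set x := c.ψ y with hxdef
  have hwd : HasFDerivAt c.w ((innerSL ℝ c.e) ∘L fderiv ℝ M.nu x) x := by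
    have := (innerSL ℝ c.e).hasFDerivAt.comp x (diff_nu M x).hasFDerivAt
    refine this.congr_of_eventuallyEq (Eventually.of_forall fun z => ?_)
    simp [Chart.w, real_inner_comm]
  have hA := ((hasFDerivAt_inv hw.ne').comp x hwd).fun_smul hY.hasFDerivAt
  have hA' : fderiv ℝ (fun x => (c.w x)⁻¹ • Y x) x =
      (c.w x)⁻¹ • fderiv ℝ Y x + (((c.w x ^ 2)⁻¹) • -((innerSL ℝ c.e) ∘L fderiv ℝ M.nu x)).smulRight (Y x) := by
    refine (HasFDerivAt.fderiv hA).trans ?_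
    ext1 v
    simp [mul_comm]
  rw [hA']
  have e1 : tr ((c.w x)⁻¹ • fderiv ℝ Y x + (((c.w x ^ 2)⁻¹) • -((innerSL ℝ c.e) ∘L fderiv ℝ M.nu x)).smulRight (Y x))
      = (c.w x)⁻¹ * tr (fderiv ℝ Y x) - (c.w x ^ 2)⁻¹ * ⟪fderiv ℝ M.nu x (Y x), c.e⟫ := by
    have : ((c.w x)⁻¹ • fderiv ℝ Y x + (((c.w x ^ 2)⁻¹) • -((innerSL ℝ c.e) ∘L fderiv ℝ M.nu x)).smulRight (Y x)).toLinearMap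
      = (c.w x)⁻¹ • (fderiv ℝ Y x).toLinearMap + ((((c.w x ^ 2)⁻¹) • -((innerSL ℝ c.e) ∘L fderiv ℝ M.nu x)).toLinearMap).smulRight (Y x) := rfl
    rw [tr, this, map_add, map_smul, LinearMap.trace_smulRight]
    simp [real_inner_comm]
    ring
  rw [e1]
  have e2 : ⟪((c.w x)⁻¹ • fderiv ℝ Y x + (((c.w x ^ 2)⁻¹) • -((innerSL ℝ c.e) ∘L fderiv ℝ M.nu x)).smulRight (Y x)) c.e, M.nu x⟫ =
      (c.w x)⁻¹ * ⟪fderiv ℝ Y x c.e, M.nu x⟫ := by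
    simp only [add_apply, ContinuousLinearMap.smulRight_apply, inner_add_left, real_inner_smul_left, hYt x hx, smul_apply, mul_zero, add_zero]
  rw [e2]
  set t := c.e - c.w x • M.nu x with ht
  have htn : ⟪t, M.nu x⟫ = 0 := by
    rw [ht, inner_sub_left, real_inner_smul_left, nu_nu M hx, real_inner_comm]
    simp [Chart.w]
  have het : c.e = c.w x • M.nu x + t := by rw [ht]; abel
  have e3 : ⟪fderiv ℝ Y x c.e, M.nu x⟫ = c.w x * ⟪fderiv ℝ Y x (M.nu x), M.nu x⟫ - ⟪Y x, fderiv ℝ M.nu x t⟫ := by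
    rw [het, map_add, map_smul, inner_add_left, real_inner_smul_left, dY_nu M hx htn hY hYt]; ring
  have e4 : ⟪fderiv ℝ M.nu x (Y x), c.e⟫ = ⟪Y x, fderiv ℝ M.nu x t⟫ := by
    rw [het, inner_add_right, real_inner_smul_right, dnu_nu M hx (hYt x hx), shape_symm M hx (hYt x hx) htn,
      real_inner_comm]; ring
  rw [e3, e4]
  field_simp
  ring

end Chart
end MSA

namespace MSA
open Set Filter Topology
open scoped ENNReal NNReal

instance haarEp : Measure.IsAddHaarMeasure (μH[(n : ℝ)] : Measure (Ep n)) := by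
  simpa using MeasureTheory.isAddHaarMeasure_hausdorffMeasure (E := Ep n)

lemma continuous_tdiv {ν Y : Eu n → Eu n} (hν : Continuous ν) (hY : ContDiff ℝ 1 Y) :
    Continuous (tdiv ν Y) := by
  have hd : Differentiable ℝ Y := hY.differentiable (by simp)
  have hc : Continuous (fderiv ℝ Y) := hY.continuous_fderiv (by simp)
  have : tdiv ν Y = fun x => ∑ i, fderiv ℝ Y x (EuclideanSpace.single i 1) i - ⟪fderiv ℝ Y x (ν x), ν x⟫ := by
    ext x
    rw [tdiv_eq ν (hd x), tr_sum]
  rw [this]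
  fun_prop

lemma integral_fderiv_zero {u : Ep n → Ep n} (hu : ContDiff ℝ 1 u) (hs : HasCompactSupport u) :
    ∫ y, tr (fderiv ℝ u y) ∂μH[(n : ℝ)] = 0 := by
  have hd : Differentiable ℝ u := hu.differentiable (by simp)
  have hc : Continuous (fderiv ℝ u) := hu.continuous_fderiv (by simp)
  have hi : ∀ i : Fin n, Integrable (fun y => fderiv ℝ u y (EuclideanSpace.single i 1) i) μH[(n : ℝ)] := by
    intro i
    refine Continuous.integrable_of_hasCompactSupport (by fun_prop) ?_
    refine (hs.fderiv ℝ).comp_left (g := fun A : Ep n →L[ℝ] Ep n => A (EuclideanSpace.single i 1) i) (by simp)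
  simp_rw [tr_sum]
  rw [integral_finsetSum _ fun i _ => hi i]
  refine Finset.sum_eq_zero fun i _ => ?_
  have hdi : ∀ y, fderiv ℝ (fun y => u y i) y (EuclideanSpace.single i 1) = fderiv ℝ u y (EuclideanSpace.single i 1) i := by
    intro y
    have h : HasFDerivAt (fun y => u y i)
        ((EuclideanSpace.proj i : Ep n →L[ℝ] ℝ).comp (fderiv ℝ u y)) y :=
      (EuclideanSpace.proj i : Ep n →L[ℝ] ℝ).hasFDerivAt.comp y (hd y).hasFDerivAt
    rw [h.fderiv]; rfl
  have := integral_mul_fderiv_eq_neg_fderiv_mul_of_integrable (μ := (μH[(n : ℝ)] : Measure (Ep n)))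
    (f := fun _ => (1 : ℝ)) (g := fun y => u y i) (v := EuclideanSpace.single i 1)
    (by simp) (by simpa [hdi] using hi i) (by
      simp only [one_mul]
      refine Continuous.integrable_of_hasCompactSupport (by fun_prop) ?_
      exact hs.comp_left (g := fun A : Ep n => A i) (by simp))
    (fun x _ => differentiableAt_const _) (fun x _ => by fun_prop)
  simpa [hdi] using this

namespace Chart
variable {M : Hypersurface n} (c : Chart M)

lemma meas_MΩ : MeasurableSet (M.carrier ∩ c.Ω) := (measurable_carrier M).inter c.hΩ.measurableSet

lemma contOn_ψ : ContinuousOn c.ψ c.B := fun y hy => (c.ψ_diff y hy).continuousAt.continuousWithinAt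

lemma change_var {F : Eu n → ℝ} (hF : Continuous F) :
    ∫ x in M.carrier ∩ c.Ω, F x ∂μH[(n : ℝ)] =
      ∫ y in c.B, (c.w (c.ψ y))⁻¹ * F (c.ψ y) ∂μH[(n : ℝ)] := by
  have h1 : ∫ x in M.carrier ∩ c.Ω, F x ∂μH[(n : ℝ)] = ∫ x in M.carrier ∩ c.Ω, (F ∘ c.ψ) (c.P x) ∂μH[(n : ℝ)] :=
    setIntegral_congr_fun c.meas_MΩ fun x hx => by simp [c.ψ_P x hx]
  have hg : ContinuousOn (F ∘ c.ψ) c.B := hF.comp_continuousOn c.contOn_ψ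
  have hwc : ContinuousOn (fun y => (c.w (c.ψ y))⁻¹) c.B :=
    (c.continuous_w.comp_continuousOn c.contOn_ψ).inv₀ fun y hy => (c.w_pos' (c.ψ_mem y hy).2).ne'
  have hga : AEStronglyMeasurable (F ∘ c.ψ) ((μH[(n : ℝ)] : Measure (Ep n)).restrict c.B) :=
    hg.aestronglyMeasurable c.hB.measurableSet
  rw [h1, ← integral_map (μ := (μH[(n : ℝ)] : Measure (Eu n)).restrict (M.carrier ∩ c.Ω)) (f := F ∘ c.ψ) c.P.continuous.aemeasurable, c.area,
    integral_withDensity_eq_integral_toReal_smul₀]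
  · refine setIntegral_congr_fun c.hB.measurableSet fun y hy => ?_
    have := c.w_pos' (c.ψ_mem y hy).2
    simp [ENNReal.toReal_ofReal (inv_nonneg.2 this.le)]
  · exact (hwc.aemeasurable c.hB.measurableSet).ennreal_ofReal
  · exact Eventually.of_forall fun y => ENNReal.ofReal_lt_top
  · rw [c.area]
    exact hga.mono_ac (withDensity_absolutelyContinuous _ _)

lemma div_zero {Y : Eu n → Eu n} (hY : ContDiff ℝ 1 Y) (hs : HasCompactSupport Y)
    (hsΩ : tsupport Y ⊆ c.Ω) (hYt : ∀ z ∈ M.carrier, ⟪Y z, M.nu z⟫ = 0) :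
    ∫ x in M.carrier ∩ c.Ω, tdiv M.nu Y x ∂μH[(n : ℝ)] = 0 := by
  have hd : Differentiable ℝ Y := hY.differentiable (by simp)
  rw [c.change_var (continuous_tdiv (contDiff_nu M 0).continuous hY)]
  obtain ⟨f, hf, hfM⟩ := c.closedM
  have hK : IsCompact (tsupport Y ∩ {x | f x = 0}) :=
    IsCompact.inter_right hs (isClosed_eq hf continuous_const)
  have hKe : tsupport Y ∩ {x | f x = 0} ⊆ M.carrier ∩ c.Ω := by
    rintro x ⟨hx, hfx⟩
    rw [hfM]; exact ⟨hsΩ hx, hfx⟩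
  set K' := c.P '' (tsupport Y ∩ {x | f x = 0}) with hK'
  have hK'c : IsCompact K' := hK.image c.P.continuous
  have hK'B : K' ⊆ c.B := by
    rintro _ ⟨x, hx, rfl⟩
    exact c.P_mem x (hKe hx)
  have hzero : ∀ y ∈ c.B, y ∉ K' → c.fld Y y = 0 := by
    intro y hy hyK
    by_cases h : Y (c.ψ y) = 0
    · simp [fld, h]
    · refine absurd ⟨c.ψ y, ⟨subset_tsupport _ h, ?_⟩, c.P_ψ y hy⟩ hyK
      have := c.ψ_mem y hy
      rw [hfM] at this
      exact this.2
  set u : Ep n → Ep n := c.B.indicator (c.fld Y) with hu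
  have huB : ∀ y ∈ c.B, u =ᶠ[𝓝 y] c.fld Y := fun y hy => by
    filter_upwards [c.hB.mem_nhds hy] with z hz
    simp [hu, hz]
  have huz : ∀ y ∉ K', u y = 0 := by
    intro y hy
    by_cases hyB : y ∈ c.B
    · simp [hu, hyB, hzero y hyB hy]
    · simp [hu, hyB]
  have huC : ContDiff ℝ 1 u := by
    rw [contDiff_iff_contDiffAt]
    intro y
    by_cases hy : y ∈ c.B
    · refine ContDiffAt.congr_of_eventuallyEq ?_ (huB y hy)
      have h1 := c.ψ_diff y hy
      have h2 : ContDiffAt ℝ 1 c.w (c.ψ y) := ((contDiff_nu M 1).contDiffAt).inner ℝ contDiffAt_const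
      have h3 : ContDiffAt ℝ 1 (fun x => (c.w x)⁻¹ • Y x) (c.ψ y) :=
        (h2.inv (c.w_pos' (c.ψ_mem y hy).2).ne').smul hY.contDiffAt
      exact c.P.contDiff.contDiffAt.comp y (h3.comp y h1)
    · have : u =ᶠ[𝓝 y] fun _ => 0 := by
        filter_upwards [hK'c.isClosed.isOpen_compl.mem_nhds fun h => hy (hK'B h)] with z hz using huz z hz
      exact contDiffAt_const.congr_of_eventuallyEq this
  have hus : HasCompactSupport u := HasCompactSupport.intro hK'c huz
  rw [← integral_fderiv_zero huC hus, ← setIntegral_eq_integral_of_forall_compl_eq_zero (s := c.B)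
    (f := fun y => tr (fderiv ℝ u y))]
  · refine setIntegral_congr_fun c.hB.measurableSet fun y hy => ?_
    rw [(huB y hy).fderiv_eq, c.tr_fld hy (hd _) hYt]
  · intro y hy
    have : u =ᶠ[𝓝 y] fun _ => 0 := by
      filter_upwards [hK'c.isClosed.isOpen_compl.mem_nhds fun h => hy (hK'B h)] with z hz using huz z hz
    rw [this.fderiv_eq]
    simp [tr]

lemma finite_MΩ : μH[(n : ℝ)] (M.carrier ∩ c.Ω) < ∞ := by
  have h1 : ((μH[(n : ℝ)] : Measure (Eu n)).restrict (M.carrier ∩ c.Ω)).map c.P univ = μH[(n : ℝ)] (M.carrier ∩ c.Ω) := by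
    rw [Measure.map_apply c.P.continuous.measurable MeasurableSet.univ]; simp
  rw [← h1, c.area, withDensity_apply _ MeasurableSet.univ, Measure.restrict_univ]
  calc _ ≤ ∫⁻ y in c.B, (2 : ℝ≥0∞) ∂μH[(n : ℝ)] := by
        refine setLIntegral_mono measurable_const fun y hy => ?_
        have := c.w_pos _ (c.ψ_mem y hy).2
        rw [show (2 : ℝ≥0∞) = ENNReal.ofReal 2 by simp]
        refine ENNReal.ofReal_le_ofReal (inv_le_of_inv_le₀ (by norm_num) ?_)
        simp only [Chart.w]; linarith
    _ = 2 * μH[(n : ℝ)] c.B := by simp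
    _ < ∞ := ENNReal.mul_lt_top (by simp) c.bB.measure_lt_top

end Chart

lemma finite_compact (M : Hypersurface n) {K : Set (Eu n)} (hK : IsCompact K) (hKM : K ⊆ M.carrier) :
    μH[(n : ℝ)] K < ∞ := by
  have h := hK.induction_on (p := fun s => μH[(n : ℝ)] (M.carrier ∩ s) < ∞) (by simp)
    (fun s t hst ht => (measure_mono (inter_subset_inter_right _ hst)).trans_lt ht)
    (fun s t hs ht => by
      rw [inter_union_distrib_left]
      exact (measure_union_le _ _).trans_lt (ENNReal.add_lt_top.2 ⟨hs, ht⟩))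
    (fun x hx => by
      obtain ⟨c, hc, -⟩ := exists_chart M x (hKM hx)
      exact ⟨c.Ω, mem_nhdsWithin_of_mem_nhds (c.hΩ.mem_nhds hc), c.finite_MΩ⟩)
  exact (measure_mono (subset_inter hKM subset_rfl)).trans_lt h
end MSA

namespace MSA
open Set Filter Topology
open scoped ENNReal NNReal Manifold

lemma tdiv_eq_tr (ν : Eu n → Eu n) {Z : Eu n → Eu n} {x : Eu n} (hZ : DifferentiableAt ℝ Z x) :
    tdiv ν Z x = tr (fderiv ℝ Z x ∘L (ContinuousLinearMap.id ℝ (Eu n) - (innerSL ℝ (ν x)).smulRight (ν x))) := by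
  rw [tdiv_eq ν hZ]
  have : (fderiv ℝ Z x ∘L (ContinuousLinearMap.id ℝ (Eu n) - (innerSL ℝ (ν x)).smulRight (ν x))).toLinearMap
    = (fderiv ℝ Z x).toLinearMap - (innerSL ℝ (ν x)).toLinearMap.smulRight (fderiv ℝ Z x (ν x)) := by
    ext1 v; simp
  rw [tr, tr, this, map_sub, LinearMap.trace_smulRight]
  simp [real_inner_comm]

lemma tdiv_congr (M : Hypersurface n) {x : Eu n} (hx : x ∈ M.carrier) {F G : Eu n → Eu n}
    (hF : DifferentiableAt ℝ F x) (hG : DifferentiableAt ℝ G x) (h : F =ᶠ[𝓝[M.carrier] x] G) :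
    tdiv M.nu F x = tdiv M.nu G x := by
  rw [tdiv_eq_tr _ hF, tdiv_eq_tr _ hG]
  refine congrArg tr (ContinuousLinearMap.ext fun v => ?_)
  have ht : ⟪v - ⟪M.nu x, v⟫ • M.nu x, M.nu x⟫ = 0 := by
    rw [inner_sub_left, real_inner_smul_left, nu_nu M hx, real_inner_comm]; ring
  have := fderiv_tangent_congr M hx hF hG h ht
  simpa using this

lemma tdiv_smul (ν : Eu n → Eu n) {f : Eu n → ℝ} {Z : Eu n → Eu n} {x : Eu n}
    (hf : DifferentiableAt ℝ f x) (hZ : DifferentiableAt ℝ Z x) :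
    tdiv ν (fun y => f y • Z y) x = f x * tdiv ν Z x + ⟪tgrad ν f x, Z x⟫ := by
  rw [tdiv_eq ν (hf.fun_smul hZ), tdiv_eq ν hZ, tgrad_inner, fderiv_fun_smul hf hZ]
  have : (f x • fderiv ℝ Z x + (fderiv ℝ f x).smulRight (Z x)).toLinearMap =
    f x • (fderiv ℝ Z x).toLinearMap + (fderiv ℝ f x).toLinearMap.smulRight (Z x) := rfl
  rw [tr, this, map_add, map_smul, LinearMap.trace_smulRight]
  simp [inner_add_left, real_inner_smul_left, tr]
  ring

lemma tdiv_sub (ν : Eu n → Eu n) {Z W : Eu n → Eu n} {x : Eu n}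
    (hZ : DifferentiableAt ℝ Z x) (hW : DifferentiableAt ℝ W x) :
    tdiv ν (fun y => Z y - W y) x = tdiv ν Z x - tdiv ν W x := by
  rw [tdiv_eq ν (hZ.fun_sub hW), tdiv_eq ν hZ, tdiv_eq ν hW, fderiv_fun_sub hZ hW]
  have : (fderiv ℝ Z x - fderiv ℝ W x).toLinearMap = (fderiv ℝ Z x).toLinearMap - (fderiv ℝ W x).toLinearMap := rfl
  rw [tr, this, map_sub]
  simp [inner_sub_left]
  ring

lemma tdiv_sum (ν : Eu n → Eu n) {ι : Type*} (s : Finset ι) {Z : ι → Eu n → Eu n} {x : Eu n}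
    (hZ : ∀ i, DifferentiableAt ℝ (Z i) x) :
    tdiv ν (fun y => ∑ i ∈ s, Z i y) x = ∑ i ∈ s, tdiv ν (Z i) x := by
  rw [tdiv_eq_tr ν (by fun_prop), fderiv_fun_sum fun i _ => hZ i]
  simp_rw [fun i => tdiv_eq_tr ν (hZ i)]
  simp only [tr]
  rw [← map_sum]
  congr 1
  ext1 v
  simp [LinearMap.sum_apply]

lemma tdiv_zero_of (M : Hypersurface n) {K : Set (Eu n)} (hK : IsCompact K) {Y : Eu n → Eu n}
    (hd : Differentiable ℝ Y) (hY0 : ∀ x ∈ M.carrier, x ∉ K → Y x = 0) :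
    ∀ x ∈ M.carrier, x ∉ K → tdiv M.nu Y x = 0 := by
  intro x hx hxK
  rw [tdiv_congr M hx (hd x) (differentiableAt_const (0 : Eu n))]
  · rw [tdiv_eq _ (differentiableAt_const _)]; simp [tr]
  · filter_upwards [self_mem_nhdsWithin, mem_nhdsWithin_of_mem_nhds (hK.isClosed.isOpen_compl.mem_nhds hxK)] with z h1 h2
    exact hY0 z h1 h2

lemma integrableOn_K (M : Hypersurface n) {K : Set (Eu n)} (hK : IsCompact K) (hKM : K ⊆ M.carrier)
    {F : Eu n → ℝ} (hF : Continuous F) : IntegrableOn F K μH[(n : ℝ)] := by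
  have : IsFiniteMeasure ((μH[(n : ℝ)] : Measure (Eu n)).restrict K) :=
    ⟨by simpa using finite_compact M hK hKM⟩
  obtain ⟨C, hC⟩ := hK.exists_bound_of_continuousOn hF.continuousOn
  exact Integrable.of_bound hF.aestronglyMeasurable C
    ((ae_restrict_iff' hK.measurableSet).2 (Eventually.of_forall hC))

lemma div_tangent (M : Hypersurface n) {K : Set (Eu n)} (hK : IsCompact K) (hKM : K ⊆ M.carrier)
    {Y : Eu n → Eu n} (hY : ContDiff ℝ 1 Y) (hYt : ∀ z ∈ M.carrier, ⟪Y z, M.nu z⟫ = 0)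
    (hY0 : ∀ x ∈ M.carrier, x ∉ K → Y x = 0) :
    ∫ x in K, tdiv M.nu Y x ∂μH[(n : ℝ)] = 0 := by
  have hd : Differentiable ℝ Y := hY.differentiable (by simp)
  have : ∀ x : K, ∃ c : Chart M, (x : Eu n) ∈ c.Ω := fun x => (exists_chart M x (hKM x.2)).imp fun c hc => hc.1
  choose c hc using this
  let U : K → Set (Eu n) := fun x => (c x).Ω ∩ Metric.ball (x : Eu n) 1
  have hUo : ∀ x, IsOpen (U x) := fun x => (c x).hΩ.inter Metric.isOpen_ball
  obtain ⟨t, ht⟩ := hK.elim_finite_subcover U hUo fun x hx =>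
    mem_iUnion.2 ⟨⟨x, hx⟩, hc ⟨x, hx⟩, by simp⟩
  obtain ⟨f, hf⟩ := SmoothPartitionOfUnity.exists_isSubordinate 𝓘(ℝ, Eu n) hK.isClosed
    (fun i : t => U i) (fun i => hUo i) (fun x hx => by
      obtain ⟨i, hi, hx⟩ := mem_iUnion₂.1 (ht hx)
      exact mem_iUnion.2 ⟨⟨i, hi⟩, hx⟩)
  have hfs : ∀ i : t, ContDiff ℝ 1 (f i) := fun i =>
    (contMDiff_iff_contDiff.1 (f i).contMDiff).of_le (by exact_mod_cast le_top)
  have hZ : ∀ i : t, ContDiff ℝ 1 (fun x => f i x • Y x) := fun i => (hfs i).smul hY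
  have hZd : ∀ i : t, Differentiable ℝ (fun x => f i x • Y x) := fun i => (hZ i).differentiable (by simp)
  have hνc : Continuous M.nu := (contDiff_nu M 0).continuous
  have e1 : ∀ x ∈ K, tdiv M.nu Y x = ∑ i : t, tdiv M.nu (fun x => f i x • Y x) x := by
    intro x hx
    rw [← tdiv_sum _ _ fun i => hZd i x]
    refine tdiv_congr M (hKM hx) (hd x) (DifferentiableAt.fun_sum fun i _ => hZd i x) ?_
    filter_upwards [self_mem_nhdsWithin] with z hz
    by_cases hzK : z ∈ K
    · have := f.sum_eq_one hzK
      rw [finsum_eq_sum_of_fintype] at this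
      rw [← Finset.sum_smul, this, one_smul]
    · simp [hY0 z hz hzK]
  rw [setIntegral_congr_fun hK.measurableSet e1, integral_finsetSum _ fun i _ =>
    integrableOn_K M hK hKM (continuous_tdiv hνc (hZ i))]
  refine Finset.sum_eq_zero fun i _ => ?_
  have hz : ∀ x ∈ M.carrier, x ∉ K → tdiv M.nu (fun x => f i x • Y x) x = 0 :=
    tdiv_zero_of M hK (hZd i) fun x h1 h2 => by simp [hY0 x h1 h2]
  have hsupp : tsupport (fun x => f i x • Y x) ⊆ tsupport (f i) := tsupport_smul_subset_left _ _
  have hbd : HasCompactSupport (fun x => f i x • Y x) := by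
    refine Metric.isCompact_of_isClosed_isBounded (isClosed_tsupport _) ?_
    exact Metric.isBounded_ball.subset ((hsupp.trans (hf i)).trans inter_subset_right)
  have h0 := (c i).div_zero (hZ i) hbd ((hsupp.trans (hf i)).trans inter_subset_left) fun z hz => by
    rw [real_inner_smul_left, hYt z hz, mul_zero]
  have h1 : ∫ x in M.carrier, tdiv M.nu (fun x => f i x • Y x) x ∂μH[(n : ℝ)] = ∫ x in K, tdiv M.nu (fun x => f i x • Y x) x ∂μH[(n : ℝ)] :=
    setIntegral_eq_of_subset_of_forall_sdiff_eq_zero (measurable_carrier M) hKM fun x hx => hz x hx.1 hx.2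
  have h2 : ∫ x in M.carrier, tdiv M.nu (fun x => f i x • Y x) x ∂μH[(n : ℝ)] = ∫ x in M.carrier ∩ (c i).Ω, tdiv M.nu (fun x => f i x • Y x) x ∂μH[(n : ℝ)] :=
    setIntegral_eq_of_subset_of_forall_sdiff_eq_zero (measurable_carrier M) inter_subset_left fun x hx => by
      have hxs : x ∉ tsupport (fun x => f i x • Y x) := fun h => hx.2 ⟨hx.1, (hf i (hsupp h)).1⟩
      rw [tdiv_eq _ (hZd i x), fderiv_of_notMem_tsupport (𝕜 := ℝ) hxs]
      simp [tr]
  rw [← h1, h2, h0]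

theorem first_variation (M : Hypersurface n) {K : Set (Eu n)} (hK : IsCompact K) (hKM : K ⊆ M.carrier)
    {X : Eu n → Eu n} (hX : ContDiff ℝ 1 X) (hX0 : ∀ x ∈ M.carrier, x ∉ K → X x = 0) :
    ∫ x in K, (tdiv M.nu X x - meanCurv M x * ⟪X x, M.nu x⟫) ∂μH[(n : ℝ)] = 0 := by
  have hd : Differentiable ℝ X := hX.differentiable (by simp)
  have hν := contDiff_nu M 1
  have hi : ContDiff ℝ 1 (fun x => ⟪X x, M.nu x⟫) := hX.inner ℝ hν
  rw [← div_tangent M hK hKM (Y := fun x => X x - ⟪X x, M.nu x⟫ • M.nu x) (hX.sub (hi.smul hν))]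
  · refine setIntegral_congr_fun hK.measurableSet fun x hx => ?_
    have hxd := hi.differentiable (by simp) x
    rw [tdiv_sub _ (hd x) (hxd.fun_smul (diff_nu M x)), tdiv_smul _ hxd (diff_nu M x), tgrad_inner, nu_nu M (hKM hx)]
    simp [meanCurv, mul_comm]
  · intro z hz
    rw [inner_sub_left, real_inner_smul_left, nu_nu M hz]; simp
  · intro x h1 h2
    simp [hX0 x h1 h2]
end MSA

namespace MSA
open Set Filter Topology
open scoped ENNReal NNReal

/-- density constant -/
def cden (n : ℕ) : ℝ := (1 / 2) * ((1 / 2) ^ n * (μH[(n : ℝ)] : Measure (Ep n)).real (Metric.ball 0 1))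

lemma cden_pos : 0 < cden n := by
  have h1 : 0 < (μH[(n : ℝ)] : Measure (Ep n)).real (Metric.ball 0 1) :=
    ENNReal.toReal_pos (Metric.measure_ball_pos _ _ one_pos).ne' measure_ball_lt_top.ne
  unfold cden; positivity

lemma density (M : Hypersurface n) {K : Set (Eu n)} (hK : IsCompact K) (hKM : K ⊆ M.carrier)
    {h : Eu n → ℝ} (hc : Continuous h) (hnn : ∀ x, 0 ≤ h x) (h0 : ∀ x ∈ M.carrier, x ∉ K → h x = 0)
    {ξ : Eu n} (hξ : ξ ∈ M.carrier) (hξ1 : h ξ = 1) :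
    ∃ σ₀ > 0, ∀ σ, 0 < σ → σ < σ₀ →
      cden n * σ ^ n ≤ ∫ x in K ∩ Metric.closedBall ξ σ, h x ∂μH[(n : ℝ)] := by
  obtain ⟨c, hξΩ, hce⟩ := exists_chart M ξ hξ
  set y₀ := c.P ξ with hy₀
  have hy₀B : y₀ ∈ c.B := c.P_mem ξ ⟨hξ, hξΩ⟩
  have hψ : c.ψ y₀ = ξ := c.ψ_P ξ ⟨hξ, hξΩ⟩
  have hd := (c.ψ_diff y₀ hy₀B).differentiableAt (by simp)
  have ha : c.a y₀ = 0 := by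
    rw [Chart.a, hψ, ← hce, c.P_e, smul_zero]
  have hfd : ∀ v, fderiv ℝ c.ψ y₀ v = c.J v := fun v => by
    rw [c.fderiv_ψ hy₀B, ha]; simp
  have ev1 : ∀ᶠ y in 𝓝 y₀, ‖c.ψ y - ξ‖ ≤ 2 * ‖y - y₀‖ := by
    have := hd.hasFDerivAt.isLittleO.bound (c := 1) one_pos
    filter_upwards [this] with y hy
    rw [hψ, hfd] at hy
    have := norm_add_le (c.ψ y - ξ - c.J (y - y₀)) (c.J (y - y₀))
    rw [sub_add_cancel, c.norm_J] at this
    linarith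
  have ev2 : ∀ᶠ y in 𝓝 y₀, 1 / 2 < h (c.ψ y) := by
    have : ContinuousAt (fun y => h (c.ψ y)) y₀ := hc.continuousAt.comp hd.continuousAt
    refine this.eventually_const_lt ?_
    change 1 / 2 < h (c.ψ y₀)
    rw [hψ, hξ1]; norm_num
  obtain ⟨δ, hδ, hball⟩ := Metric.eventually_nhds_iff_ball.1 ((ev1.and ev2).and (c.hB.mem_nhds hy₀B))
  refine ⟨δ, hδ, fun σ hσ hσδ => ?_⟩
  have hfin : μH[(n : ℝ)] (K ∩ Metric.closedBall ξ σ) < ∞ :=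
    (measure_mono inter_subset_left).trans_lt (finite_compact M hK hKM)
  set S := {x | 1 / 2 ≤ h x} ∩ (K ∩ Metric.closedBall ξ σ) with hS
  have hsub : Metric.ball y₀ (σ / 2) ⊆ c.P '' S := by
    intro y hy
    have hy' : y ∈ Metric.ball y₀ δ := Metric.ball_subset_ball (by linarith) hy
    obtain ⟨⟨e1, e2⟩, e3⟩ := hball y hy'
    have e3 : y ∈ c.B := e3
    refine ⟨c.ψ y, ⟨e2.le, ?_, ?_⟩, c.P_ψ y e3⟩
    · by_contra hcon
      have := h0 _ (c.ψ_mem y e3).1 hcon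
      linarith
    · rw [Metric.mem_closedBall, dist_eq_norm]
      rw [Metric.mem_ball, dist_eq_norm] at hy
      linarith
  have hLip : LipschitzWith 1 c.P := by
    refine LipschitzWith.of_dist_le_mul fun x y => ?_
    rw [dist_eq_norm, dist_eq_norm, ← map_sub]
    simpa using c.norm_P_le (x - y)
  have hm : μH[(n : ℝ)] (Metric.ball y₀ (σ / 2)) ≤ μH[(n : ℝ)] S := by
    have := hLip.hausdorffMeasure_image_le (d := n) (by positivity) S
    simp only [ENNReal.coe_one, ENNReal.one_rpow, one_mul] at this
    exact (measure_mono hsub).trans this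
  have hSfin : μH[(n : ℝ)] S < ∞ := (measure_mono inter_subset_right).trans_lt hfin
  have hm' : (σ / 2) ^ n * (μH[(n : ℝ)] : Measure (Ep n)).real (Metric.ball 0 1) ≤ (μH[(n : ℝ)] : Measure (Eu n)).real S := by
    have := ENNReal.toReal_mono hSfin.ne hm
    rw [Measure.addHaar_ball_of_pos _ _ (by positivity)] at this
    rw [ENNReal.toReal_mul, ENNReal.toReal_ofReal (by positivity)] at this
    simpa [Measure.real] using this
  have hint : IntegrableOn h (K ∩ Metric.closedBall ξ σ) μH[(n : ℝ)] :=
    (integrableOn_K M hK hKM hc).mono_set inter_subset_left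
  have := mul_meas_ge_le_integral_of_nonneg (μ := (μH[(n : ℝ)] : Measure (Eu n)).restrict (K ∩ Metric.closedBall ξ σ))
    (Eventually.of_forall hnn) hint (1 / 2)
  rw [measureReal_restrict_apply (measurableSet_le measurable_const hc.measurable)] at this
  refine le_trans ?_ this
  rw [cden, mul_assoc]
  refine mul_le_mul_of_nonneg_left (le_trans (le_of_eq ?_) hm') (by norm_num)
  rw [div_pow, div_pow]; ring

/-- the cutoff -/
def G (s : ℝ) : ℝ := Real.smoothTransition (2 - s)

lemma G_contDiff : ContDiff ℝ 1 G := Real.smoothTransition.contDiff.comp (contDiff_const.sub contDiff_id)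
lemma G_nonneg (s : ℝ) : 0 ≤ G s := Real.smoothTransition.nonneg _
lemma G_le_one (s : ℝ) : G s ≤ 1 := Real.smoothTransition.le_one _
lemma G_one {s : ℝ} (h : s ≤ 1) : G s = 1 := Real.smoothTransition.one_of_one_le (by linarith)
lemma G_zero {s : ℝ} (h : 2 ≤ s) : G s = 0 := Real.smoothTransition.zero_of_nonpos (by linarith)
lemma G_anti : Antitone G := fun a b hab => Real.smoothTransition.monotone (by linarith)
lemma G_diff : Differentiable ℝ G := G_contDiff.differentiable (by simp)
lemma G_deriv_nonpos (s : ℝ) : deriv G s ≤ 0 := G_anti.deriv_nonpos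
lemma G_deriv_bdd : ∃ C, ∀ s, |deriv G s| ≤ C := by
  have hs : HasCompactSupport (deriv G) := by
    refine HasCompactSupport.intro (K := Icc 1 2) isCompact_Icc fun s hs => ?_
    rw [mem_Icc, not_and_or, not_le, not_le] at hs
    rcases hs with hs | hs
    · have : G =ᶠ[𝓝 s] fun _ => 1 := by
        filter_upwards [Iio_mem_nhds hs] with z hz using G_one (le_of_lt hz)
      rw [this.deriv_eq]; simp
    · have : G =ᶠ[𝓝 s] fun _ => 0 := by
        filter_upwards [Ioi_mem_nhds hs] with z hz using G_zero (le_of_lt hz)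
      rw [this.deriv_eq]; simp
  obtain ⟨C, hC⟩ := (hs.isCompact_range (G_contDiff.continuous_deriv (by simp))).isBounded.exists_norm_le
  exact ⟨C, fun s => hC _ ⟨s, rfl⟩⟩
end MSA

namespace MSA
open Set Filter Topology
open scoped ENNReal NNReal

lemma continuous_tgrad {ν : Eu n → Eu n} (hν : Continuous ν) {h : Eu n → ℝ} (hh : ContDiff ℝ 1 h) :
    Continuous (tgrad ν h) := by
  have hc : Continuous (fderiv ℝ h) := hh.continuous_fderiv (by simp)
  have hg : Continuous (gradient h) := (InnerProductSpace.toDual ℝ (Eu n)).symm.continuous.comp hc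
  unfold tgrad
  fun_prop

/-- right-hand side density -/
def rhs (M : Hypersurface n) (h : Eu n → ℝ) (x : Eu n) : ℝ := ‖tgrad M.nu h x‖ + |meanCurv M x| * |h x|

lemma continuous_meanCurv (M : Hypersurface n) : Continuous (meanCurv M) :=
  continuous_tdiv (contDiff_nu M 0).continuous (contDiff_nu M 1)

lemma continuous_rhs (M : Hypersurface n) {h : Eu n → ℝ} (hh : ContDiff ℝ 1 h) : Continuous (rhs M h) := by
  have h1 := continuous_tgrad (contDiff_nu M 0).continuous hh
  have h2 := continuous_meanCurv M
  have h3 := hh.continuous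
  unfold rhs
  fun_prop

lemma rhs_nonneg (M : Hypersurface n) (h : Eu n → ℝ) (x : Eu n) : 0 ≤ rhs M h x := by
  unfold rhs; positivity

/-- squared scaled distance -/
def sq (ξ : Eu n) (ρ : ℝ) (x : Eu n) : ℝ := ‖x - ξ‖ ^ 2 / ρ ^ 2

lemma pointwise (M : Hypersurface n) {h : Eu n → ℝ} (hh : ContDiff ℝ 1 h) (hnn : ∀ x, 0 ≤ h x)
    (ξ : Eu n) {ρ : ℝ} (hρ : 0 < ρ) {x : Eu n} (hx : x ∈ M.carrier) :
    n * (h x * G (sq ξ ρ x)) + 2 * (h x * (deriv G (sq ξ ρ x) * sq ξ ρ x)) - 2 * ρ * (rhs M h x * G (sq ξ ρ x)) ≤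
      tdiv M.nu (fun z => (h z * G (sq ξ ρ z)) • (z - ξ)) x -
        meanCurv M x * ⟪(h x * G (sq ξ ρ x)) • (x - ξ), M.nu x⟫ := by
  have hhd : DifferentiableAt ℝ h x := hh.differentiable (by simp) x
  have hsq : HasFDerivAt (sq ξ ρ) ((2 / ρ ^ 2) • innerSL ℝ (x - ξ)) x := by
    have h1 : HasFDerivAt (fun z : Eu n => ‖z - ξ‖ ^ 2) (2 • innerSL ℝ (x - ξ)) x := by
      have := ((hasFDerivAt_id x).sub_const ξ).norm_sq
      simpa using this
    have h2 := h1.mul_const ((ρ ^ 2)⁻¹)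
    refine (h2.congr_of_eventuallyEq (Eventually.of_forall fun z => ?_)).congr_fderiv ?_
    · simp [sq, div_eq_mul_inv]
    · ext v; simp; ring
  have hGd : HasFDerivAt (fun z => G (sq ξ ρ z)) (deriv G (sq ξ ρ x) • ((2 / ρ ^ 2) • innerSL ℝ (x - ξ))) x :=
    (G_diff _).hasDerivAt.comp_hasFDerivAt x hsq
  have hprod := hhd.hasFDerivAt.fun_mul hGd
  have hidd : DifferentiableAt ℝ (fun z : Eu n => z - ξ) x := by fun_prop
  rw [tdiv_smul M.nu hprod.differentiableAt hidd]
  have hid : tdiv M.nu (fun z : Eu n => z - ξ) x = n := by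
    have hf : fderiv ℝ (fun z : Eu n => z - ξ) x = ContinuousLinearMap.id ℝ (Eu n) := by
      rw [fderiv_sub_const]; exact fderiv_fun_id
    rw [tdiv_eq _ hidd, hf]
    have : tr (ContinuousLinearMap.id ℝ (Eu n)) = n + 1 := by
      rw [tr_sum]; simp
    rw [this, ContinuousLinearMap.id_apply, nu_nu M hx]; ring
  rw [hid, tgrad_inner, hprod.fderiv]
  set s := sq ξ ρ x with hs
  set t := (x - ξ) - ⟪x - ξ, M.nu x⟫ • M.nu x with ht
  have hDh : fderiv ℝ h x t = ⟪tgrad M.nu h x, x - ξ⟫ := (tgrad_inner _ _ _ _).symm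
  have e1 : |⟪tgrad M.nu h x, x - ξ⟫| ≤ ‖tgrad M.nu h x‖ * ‖x - ξ‖ := abs_real_inner_le_norm _ _
  have e2 : ⟪x - ξ, t⟫ ≤ ‖x - ξ‖ ^ 2 := by
    rw [ht, inner_sub_right, real_inner_self_eq_norm_sq, real_inner_smul_right]
    nlinarith [sq_nonneg ⟪x - ξ, M.nu x⟫]
  have e3 : |⟪x - ξ, M.nu x⟫| ≤ ‖x - ξ‖ := by
    have := abs_real_inner_le_norm (x - ξ) (M.nu x)
    rwa [M.unit_nu x hx, mul_one] at this
  have hG0 := G_nonneg s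
  have hG' := G_deriv_nonpos s
  have hh0 := hnn x
  have e4 : G s * ‖x - ξ‖ ≤ G s * (2 * ρ) := by
    rcases le_or_gt s 2 with h2 | h2
    · refine mul_le_mul_of_nonneg_left ?_ hG0
      have : ‖x - ξ‖ ^ 2 ≤ 2 * ρ ^ 2 := by
        rw [hs, sq, div_le_iff₀ (by positivity)] at h2; exact h2
      nlinarith [norm_nonneg (x - ξ)]
    · rw [G_zero h2.le]; simp
  have e5 : 2 / ρ ^ 2 * ⟪x - ξ, t⟫ ≤ 2 * s := by
    rw [hs, sq, mul_div_assoc', div_mul_eq_mul_div]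
    gcongr
  have e6 : h x * (deriv G s * (2 * s)) ≤ h x * (deriv G s * (2 / ρ ^ 2 * ⟪x - ξ, t⟫)) :=
    mul_le_mul_of_nonneg_left (mul_le_mul_of_nonpos_left e5 hG') hh0
  simp only [add_apply, smul_apply, innerSL_apply_apply, smul_eq_mul, hDh, real_inner_smul_left]
  have e7 : meanCurv M x * (h x * G s * ⟪x - ξ, M.nu x⟫) ≤ |meanCurv M x| * h x * (G s * ‖x - ξ‖) := by
    have : meanCurv M x * ⟪x - ξ, M.nu x⟫ ≤ |meanCurv M x| * ‖x - ξ‖ :=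
      (le_abs_self _).trans (by rw [abs_mul]; gcongr)
    nlinarith [mul_nonneg hh0 hG0]
  have e8 : -(‖tgrad M.nu h x‖ * (G s * ‖x - ξ‖)) ≤ G s * ⟪tgrad M.nu h x, x - ξ⟫ := by
    have := neg_le_of_abs_le e1
    nlinarith
  have e9 : (‖tgrad M.nu h x‖ + |meanCurv M x| * h x) * (G s * ‖x - ξ‖) ≤ (‖tgrad M.nu h x‖ + |meanCurv M x| * h x) * (G s * (2 * ρ)) :=
    mul_le_mul_of_nonneg_left e4 (by positivity)
  have e10 : rhs M h x = ‖tgrad M.nu h x‖ + |meanCurv M x| * h x := by rw [rhs, abs_of_nonneg hh0]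
  rw [e10]
  linarith

lemma continuous_sq (ξ : Eu n) (ρ : ℝ) : Continuous (sq ξ ρ) := by unfold sq; fun_prop

/-- weighted integral -/
def II (K : Set (Eu n)) (h : Eu n → ℝ) (ξ : Eu n) (ρ : ℝ) : ℝ := ∫ x in K, h x * G (sq ξ ρ x) ∂μH[(n : ℝ)]

lemma mono_ineq (M : Hypersurface n) {K : Set (Eu n)} (hK : IsCompact K) (hKM : K ⊆ M.carrier)
    {h : Eu n → ℝ} (hh : ContDiff ℝ 1 h) (hnn : ∀ x, 0 ≤ h x)
    (h0 : ∀ x ∈ M.carrier, x ∉ K → h x = 0) (ξ : Eu n) {ρ : ℝ} (hρ : 0 < ρ) :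
    n * II K h ξ ρ + 2 * ∫ x in K, h x * (deriv G (sq ξ ρ x) * sq ξ ρ x) ∂μH[(n : ℝ)] ≤
      2 * ρ * II K (rhs M h) ξ ρ := by
  have hs := continuous_sq ξ ρ
  have hGc : Continuous G := G_contDiff.continuous
  have hG'c : Continuous (deriv G) := G_contDiff.continuous_deriv (by simp)
  have hr := continuous_rhs M hh
  have hhc := hh.continuous
  have hsC : ContDiff ℝ 1 (sq ξ ρ) := by
    unfold sq
    exact ((contDiff_id.sub contDiff_const).norm_sq ℝ).div_const _
  have hX : ContDiff ℝ 1 (fun z => (h z * G (sq ξ ρ z)) • (z - ξ)) :=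
    (hh.mul (G_contDiff.comp hsC)).smul (contDiff_id.sub contDiff_const)
  have fv := first_variation M hK hKM hX (fun x h1 h2 => by simp [h0 x h1 h2])
  have i1 : IntegrableOn (fun x => h x * G (sq ξ ρ x)) K μH[(n : ℝ)] := integrableOn_K M hK hKM (by fun_prop)
  have i2 : IntegrableOn (fun x => h x * (deriv G (sq ξ ρ x) * sq ξ ρ x)) K μH[(n : ℝ)] := integrableOn_K M hK hKM (by fun_prop)
  have i3 : IntegrableOn (fun x => rhs M h x * G (sq ξ ρ x)) K μH[(n : ℝ)] := integrableOn_K M hK hKM (by fun_prop)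
  have i4 := continuous_tdiv (contDiff_nu M 0).continuous hX
  have i5 := continuous_meanCurv M
  have i6 : Continuous M.nu := (contDiff_nu M 0).continuous
  have key := setIntegral_mono_on (μ := μH[(n : ℝ)]) (s := K) (((i1.const_mul (n : ℝ)).add (i2.const_mul 2)).sub (i3.const_mul (2 * ρ)))
    (integrableOn_K M hK hKM (F := fun x => tdiv M.nu (fun z => (h z * G (sq ξ ρ z)) • (z - ξ)) x -
        meanCurv M x * ⟪(h x * G (sq ξ ρ x)) • (x - ξ), M.nu x⟫) (by fun_prop)) hK.measurableSet
    (fun x hx => pointwise M hh hnn ξ hρ (hKM hx))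
  rw [fv] at key
  simp only [Pi.sub_apply, Pi.add_apply] at key
  have i12 : IntegrableOn (fun x => n * (h x * G (sq ξ ρ x)) + 2 * (h x * (deriv G (sq ξ ρ x) * sq ξ ρ x))) K μH[(n : ℝ)] :=
    (i1.const_mul (n : ℝ)).add (i2.const_mul 2)
  rw [integral_sub i12 (i3.const_mul (2 * ρ)), integral_add (i1.const_mul (n : ℝ)) (i2.const_mul 2),
    integral_const_mul, integral_const_mul, integral_const_mul] at key
  simp only [II]
  linarith

lemma II_deriv (M : Hypersurface n) {K : Set (Eu n)} (hK : IsCompact K) (hKM : K ⊆ M.carrier)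
    {h : Eu n → ℝ} (ξ : Eu n) (hhc : Continuous h) {ρ : ℝ} (hρ : 0 < ρ) :
    HasDerivAt (II K h ξ) (-(2 / ρ) * ∫ x in K, h x * (deriv G (sq ξ ρ x) * sq ξ ρ x) ∂μH[(n : ℝ)]) ρ := by
  have hGc : Continuous G := G_contDiff.continuous
  have hG'c : Continuous (deriv G) := G_contDiff.continuous_deriv (by simp)
  obtain ⟨C, hC⟩ := G_deriv_bdd
  have hC0 : 0 ≤ C := (abs_nonneg _).trans (hC 0)
  have hs : ∀ r, Continuous (sq ξ r) := continuous_sq ξ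
  have := hasDerivAt_integral_of_dominated_loc_of_deriv_le (μ := (μH[(n : ℝ)] : Measure (Eu n)).restrict K)
    (F := fun r x => h x * G (sq ξ r x)) (F' := fun r x => h x * (deriv G (sq ξ r x) * (-(2 / r) * sq ξ r x)))
    (x₀ := ρ) (s := Metric.ball ρ (ρ / 2))
    (bound := fun x => |h x| * (C * (2 / (ρ / 2) * (‖x - ξ‖ ^ 2 / (ρ / 2) ^ 2)))) (Metric.ball_mem_nhds _ (by positivity))
    (Eventually.of_forall fun r => by
      have := hs r
      exact Continuous.aestronglyMeasurable (by fun_prop))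
    (integrableOn_K M hK hKM (by have := hs ρ; fun_prop))
    (by have := hs ρ; exact Continuous.aestronglyMeasurable (by fun_prop))
    (Eventually.of_forall fun x r hr => ?_)
    (integrableOn_K M hK hKM (by fun_prop))
    (Eventually.of_forall fun x r hr => ?_)
  · refine this.2.congr_deriv ?_
    rw [← integral_const_mul]
    congr 1; ext x; ring
  · have hr' : ρ / 2 < r := by
      rw [Metric.mem_ball, Real.dist_eq] at hr
      have := neg_lt_of_abs_lt hr; linarith
    have hr0 : 0 < r := by linarith
    rw [norm_mul, norm_mul, norm_mul, Real.norm_eq_abs, Real.norm_eq_abs, Real.norm_eq_abs, Real.norm_eq_abs, abs_neg]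
    rw [abs_of_nonneg (show 0 ≤ 2 / r by positivity), abs_of_nonneg (show 0 ≤ sq ξ r x by unfold sq; positivity)]
    unfold sq
    gcongr
    exact hC _
  · have hr' : ρ / 2 < r := by
      rw [Metric.mem_ball, Real.dist_eq] at hr
      have := neg_lt_of_abs_lt hr; linarith
    have hr0 : 0 < r := by linarith
    refine HasDerivAt.const_mul _ ?_
    refine (G_diff _).hasDerivAt.comp r ?_
    have := ((hasDerivAt_pow 2 r).inv (by positivity)).const_mul (‖x - ξ‖ ^ 2)
    refine this.congr_deriv ?_
    simp [sq]; field_simp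

end MSA

namespace MSA
open Set Filter Topology
open scoped ENNReal NNReal

lemma calc_lemma (n : ℕ) {I F : ℝ → ℝ} {m c ρ₀ : ℝ} (hc : 0 < c) (hρ₀ : 0 < ρ₀)
    (hd : ∀ ρ, 0 < ρ → ∃ d, HasDerivAt I d ρ ∧ n * I ρ - ρ * d ≤ 2 * ρ * F ρ)
    (hIm : ∀ ρ, 0 < ρ → I ρ ≤ m) (hI0 : ∀ ρ, 0 < ρ → 0 ≤ I ρ)
    (hdens : ∃ σ₀ > 0, ∀ σ, 0 < σ → σ < σ₀ → c * σ ^ n ≤ I σ)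
    (h3 : 3 * m < c * ρ₀ ^ n) :
    ∃ ρ, 0 < ρ ∧ ρ < ρ₀ ∧ I (10 * ρ) ≤ 4 * 10 ^ n * ρ₀ * F ρ := by
  by_contra! hcon
  obtain ⟨σ₀, hσ₀, hσ⟩ := hdens
  set σ := min σ₀ ρ₀ / 2 with hσdef
  have hσ1 : 0 < σ := by positivity
  have hmin : min σ₀ ρ₀ ≤ σ₀ := min_le_left _ _
  have hmin' : min σ₀ ρ₀ ≤ ρ₀ := min_le_right _ _
  have hσ2 : σ < σ₀ := by linarith
  have hσ3 : σ < ρ₀ := by linarith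
  set Q : ℝ → ℝ := fun ρ => I ρ / ρ ^ n with hQ
  have hQd : ∀ ρ, 0 < ρ → ∃ d, HasDerivAt Q d ρ ∧ -(2 * F ρ / ρ ^ n) ≤ d := by
    intro ρ hρ
    obtain ⟨d, h1, h2⟩ := hd ρ hρ
    refine ⟨_, h1.div (hasDerivAt_pow n ρ) (by positivity), ?_⟩
    rw [neg_le_iff_add_nonneg, div_add_div _ _ (by positivity) (by positivity)]
    refine div_nonneg ?_ (by positivity)
    have e : n * ρ ^ (n - 1) * ρ = n * ρ ^ n := by
      rcases Nat.eq_zero_or_pos n with h | h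
      · simp [h]
      · rw [mul_assoc, pow_sub_one_mul (by omega)]
    have : 0 ≤ ρ * (2 * F ρ * (ρ ^ n) ^ 2 + ρ ^ n * (d * ρ ^ n - I ρ * (n * ρ ^ (n - 1)))) := by
      have : ρ * (2 * F ρ * (ρ ^ n) ^ 2 + ρ ^ n * (d * ρ ^ n - I ρ * (n * ρ ^ (n - 1))))
        = (ρ ^ n) ^ 2 * (2 * ρ * F ρ + ρ * d) - ρ ^ n * (I ρ * (n * ρ ^ (n - 1) * ρ)) := by ring
      rw [this, e]
      have : (ρ ^ n) ^ 2 * (2 * ρ * F ρ + ρ * d) - ρ ^ n * (I ρ * (n * ρ ^ n)) = (ρ ^ n) ^ 2 * (2 * ρ * F ρ + ρ * d - n * I ρ) := by ring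
      rw [this]
      exact mul_nonneg (by positivity) (by linarith)
    exact nonneg_of_mul_nonneg_right (this.trans_eq (by ring)) hρ
  set L := m / ρ₀ ^ n with hL
  have hm0 : 0 ≤ m := (hI0 1 one_pos).trans (hIm 1 one_pos)
  have hL0 : 0 ≤ L := by positivity
  have hQL : ∀ ρ, ρ₀ ≤ ρ → Q ρ ≤ L := fun ρ hρ => by
    have := hIm ρ (by linarith)
    simp only [hQ, hL]
    gcongr
  have hQc : ∀ ρ, 0 < ρ → ContinuousAt Q ρ := fun ρ hρ => by
    obtain ⟨d, h, -⟩ := hQd ρ hρ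
    exact h.continuousAt
  obtain ⟨τ, hτ, hmax⟩ := isCompact_Icc.exists_isMaxOn (nonempty_Icc.2 hσ3.le)
    (f := Q) (fun ρ hρ => (hQc ρ (by linarith [hρ.1])).continuousWithinAt)
  have hτ0 : 0 < τ := by linarith [hτ.1]
  have hQτ0 : 0 ≤ Q τ := div_nonneg (hI0 τ hτ0) (by positivity)
  have hall : ∀ ρ, σ ≤ ρ → Q ρ ≤ Q τ + L := fun ρ hρ => by
    rcases le_total ρ ρ₀ with h | h
    · have : Q ρ ≤ Q τ := hmax ⟨hρ, h⟩
      linarith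
    · linarith [hQL ρ h]
  have hτ3 : Q τ ≤ 3 * L := by
    rcases hτ.2.eq_or_lt with h | h
    · have := hQL τ h.ge; linarith
    choose! Q' hQ' using hQd
    obtain ⟨ρ, hρ, hslope⟩ := exists_hasDerivAt_eq_slope Q Q' h
      (fun ρ hρ => (hQc ρ (by linarith [hρ.1])).continuousWithinAt) (fun ρ hρ => (hQ' ρ (by linarith [hρ.1])).1)
    have hρ0 : 0 < ρ := by linarith [hρ.1]
    have h1 := (hQ' ρ hρ0).2
    have h2 := hcon ρ hρ0 hρ.2
    have h4 : I (10 * ρ) = Q (10 * ρ) * (10 ^ n * ρ ^ n) := by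
      simp only [hQ]
      rw [← mul_pow, div_mul_cancel₀ _ (by positivity)]
    have h5 := hall (10 * ρ) (by linarith [hρ.1, hτ.1])
    rw [h4] at h2
    have hp : 0 < ρ ^ n := by positivity
    have h6 : F ρ / ρ ^ n ≤ (Q τ + L) / (4 * ρ₀) := by
      rw [div_le_div_iff₀ hp (by positivity)]
      have h7 : 4 * 10 ^ n * ρ₀ * F ρ < (Q τ + L) * (10 ^ n * ρ ^ n) :=
        h2.trans_le (mul_le_mul_of_nonneg_right h5 (by positivity))
      have h10 : (0 : ℝ) < 10 ^ n := by positivity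
      have : 10 ^ n * (F ρ * (4 * ρ₀)) ≤ 10 ^ n * ((Q τ + L) * ρ ^ n) := by linarith
      exact le_of_mul_le_mul_left this h10
    have h8 : -((Q τ + L) / (2 * ρ₀)) ≤ Q' ρ := by
      refine le_trans ?_ h1
      rw [neg_le_neg_iff, mul_div_assoc]
      calc _ ≤ 2 * ((Q τ + L) / (4 * ρ₀)) := by gcongr
        _ = _ := by field_simp; ring
    rw [hslope, le_div_iff₀ (by linarith)] at h8
    have h9 : (Q τ + L) / (2 * ρ₀) * (ρ₀ - τ) ≤ (Q τ + L) / 2 := by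
      have : (Q τ + L) / (2 * ρ₀) * (ρ₀ - τ) ≤ (Q τ + L) / (2 * ρ₀) * ρ₀ := by
        gcongr; linarith
      refine this.trans (le_of_eq ?_)
      field_simp
    have := hQL ρ₀ le_rfl
    linarith
  have hσQ : Q σ ≤ Q τ := hmax ⟨le_rfl, hσ3.le⟩
  have hcσ : c ≤ Q σ := by
    simp only [hQ]
    rw [le_div_iff₀ (by positivity)]
    exact hσ σ hσ1 hσ2
  have : 3 * L < c := by
    rw [hL, mul_div_assoc', div_lt_iff₀ (by positivity)]; exact h3
  linarith

lemma point_lemma (M : Hypersurface n) {K : Set (Eu n)} (hK : IsCompact K) (hKM : K ⊆ M.carrier)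
    {h : Eu n → ℝ} (hh : ContDiff ℝ 1 h) (hnn : ∀ x, 0 ≤ h x)
    (h0 : ∀ x ∈ M.carrier, x ∉ K → h x = 0) {ρ₀ : ℝ} (hρ₀ : 0 < ρ₀)
    (h3 : 3 * (∫ x in K, h x ∂μH[(n : ℝ)]) < cden n * ρ₀ ^ n) {ξ : Eu n} (hξ : ξ ∈ M.carrier) (hξ1 : h ξ = 1) :
    ∃ ρ, 0 < ρ ∧ ρ < ρ₀ ∧ ∫ x in K ∩ Metric.closedBall ξ (10 * ρ), h x ∂μH[(n : ℝ)] ≤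
      4 * 10 ^ n * ρ₀ * ∫ x in K ∩ Metric.closedBall ξ (2 * ρ), rhs M h x ∂μH[(n : ℝ)] := by
  have hGc : Continuous G := G_contDiff.continuous
  have hhc := hh.continuous
  have hs : ∀ r, Continuous (sq ξ r) := continuous_sq ξ
  have hr := continuous_rhs M hh
  have i1 : ∀ (u : Eu n → ℝ) r, Continuous u → IntegrableOn (fun x => u x * G (sq ξ r x)) K μH[(n : ℝ)] := fun u r hu => by
    have := hs r
    exact integrableOn_K M hK hKM (by fun_prop)
  have hI1 : ∀ ρ, 0 < ρ → ∫ x in K ∩ Metric.closedBall ξ ρ, h x ∂μH[(n : ℝ)] ≤ II K h ξ ρ := by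
    intro ρ hρ
    have : ∫ x in K ∩ Metric.closedBall ξ ρ, h x ∂μH[(n : ℝ)] = ∫ x in K ∩ Metric.closedBall ξ ρ, h x * G (sq ξ ρ x) ∂μH[(n : ℝ)] := by
      refine setIntegral_congr_fun (hK.measurableSet.inter Metric.isClosed_closedBall.measurableSet) fun x hx => ?_
      have hx2 := hx.2
      rw [Metric.mem_closedBall, dist_eq_norm] at hx2
      have : sq ξ ρ x ≤ 1 := by
        rw [sq, div_le_one (by positivity)]
        gcongr
      simp [G_one this]
    rw [this]
    exact setIntegral_mono_set (i1 h ρ hhc) (Eventually.of_forall fun x => mul_nonneg (hnn x) (G_nonneg _))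
      (Eventually.of_forall inter_subset_left)
  have hF1 : ∀ ρ, 0 < ρ → II K (rhs M h) ξ ρ ≤ ∫ x in K ∩ Metric.closedBall ξ (2 * ρ), rhs M h x ∂μH[(n : ℝ)] := by
    intro ρ hρ
    rw [II, setIntegral_eq_of_subset_of_forall_sdiff_eq_zero (s := K ∩ Metric.closedBall ξ (2 * ρ)) hK.measurableSet inter_subset_left]
    · refine setIntegral_mono ((i1 _ ρ hr).mono_set inter_subset_left) ((integrableOn_K M hK hKM hr).mono_set inter_subset_left) fun x => ?_
      exact mul_le_of_le_one_right (rhs_nonneg M h x) (G_le_one _)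
    · rintro x ⟨hx, hx2⟩
      have hx2 : 2 * ρ < ‖x - ξ‖ := by
        by_contra hcon
        exact hx2 ⟨hx, by rw [Metric.mem_closedBall, dist_eq_norm]; linarith⟩
      rw [G_zero, mul_zero]
      rw [sq, le_div_iff₀ (by positivity)]
      nlinarith
  obtain ⟨ρ, h1, h2, h4⟩ := calc_lemma n (I := II K h ξ) (F := II K (rhs M h) ξ) (m := ∫ x in K, h x ∂μH[(n : ℝ)]) cden_pos hρ₀
    (fun ρ hρ => ⟨_, II_deriv M hK hKM ξ hhc hρ, by
      have := mono_ineq M hK hKM hh hnn h0 ξ hρ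
      refine le_trans (le_of_eq ?_) this
      field_simp
      ring⟩)
    (fun ρ hρ => setIntegral_mono (i1 h ρ hhc) (integrableOn_K M hK hKM hhc) fun x => mul_le_of_le_one_right (hnn x) (G_le_one _))
    (fun ρ hρ => integral_nonneg fun x => mul_nonneg (hnn x) (G_nonneg _))
    (by
      obtain ⟨σ₀, hσ₀, hσ⟩ := density M hK hKM hhc hnn h0 hξ hξ1
      exact ⟨σ₀, hσ₀, fun σ h1 h2 => (hσ σ h1 h2).trans (hI1 σ h1)⟩) h3
  refine ⟨ρ, h1, h2, (hI1 _ (by positivity)).trans (h4.trans ?_)⟩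
  exact mul_le_mul_of_nonneg_left (hF1 ρ h1) (by positivity)

end MSA

namespace MSA
open Set Filter Topology
open scoped ENNReal NNReal

lemma weak_aux (M : Hypersurface n) {K : Set (Eu n)} (hK : IsCompact K) (hKM : K ⊆ M.carrier)
    {h : Eu n → ℝ} (hh : ContDiff ℝ 1 h) (hnn : ∀ x, 0 ≤ h x)
    (h0 : ∀ x ∈ M.carrier, x ∉ K → h x = 0) {ρ₀ : ℝ} (hρ₀ : 0 < ρ₀)
    (h3 : 3 * (∫ x in K, h x ∂μH[(n : ℝ)]) < cden n * ρ₀ ^ n) :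
    μH[(n : ℝ)] (K ∩ {x | h x = 1}) ≤ ENNReal.ofReal (4 * 10 ^ n * ρ₀) *
      ∫⁻ x in K, ENNReal.ofReal (rhs M h x) ∂μH[(n : ℝ)] := by
  have hhc := hh.continuous
  have hr := continuous_rhs M hh
  set μ : Measure (Eu n) := (μH[(n : ℝ)]).restrict K with hμ
  set μ₁ := μ.withDensity (fun x => ENNReal.ofReal (h x)) with hμ₁
  set μ₂ := μ.withDensity (fun x => ENNReal.ofReal (rhs M h x)) with hμ₂
  set A := K ∩ {x | h x = 1} with hA
  have hAm : MeasurableSet A := hK.measurableSet.inter (isClosed_eq hhc continuous_const).measurableSet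
  have v : ∀ (u : Eu n → ℝ) (s : Set (Eu n)), Continuous u → (∀ x, 0 ≤ u x) → MeasurableSet s →
      μ.withDensity (fun x => ENNReal.ofReal (u x)) s = ENNReal.ofReal (∫ x in K ∩ s, u x ∂μH[(n : ℝ)]) := by
    intro u s hu hu0 hs
    rw [withDensity_apply _ hs, hμ, Measure.restrict_restrict hs, inter_comm,
      ofReal_integral_eq_lintegral_ofReal ((integrableOn_K M hK hKM hu).mono_set inter_subset_left) (Eventually.of_forall hu0)]
  have key : ∀ ξ : A, ∃ ρ, 0 < ρ ∧ ρ < ρ₀ ∧ μ₁ (Metric.closedBall (ξ : Eu n) (10 * ρ)) ≤ ENNReal.ofReal (4 * 10 ^ n * ρ₀) * μ₂ (Metric.closedBall (ξ : Eu n) (2 * ρ)) := by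
    rintro ⟨ξ, hξK, hξ1⟩
    obtain ⟨ρ, h1, h2, h4⟩ := point_lemma M hK hKM hh hnn h0 hρ₀ h3 (hKM hξK) hξ1
    refine ⟨ρ, h1, h2, ?_⟩
    rw [hμ₁, hμ₂, v h _ hhc hnn Metric.isClosed_closedBall.measurableSet, v _ _ hr (rhs_nonneg M h) Metric.isClosed_closedBall.measurableSet,
      ← ENNReal.ofReal_mul (by positivity)]
    exact ENNReal.ofReal_le_ofReal h4
  choose ρ hρ0 hρ1 hρ2 using key
  obtain ⟨u, -, hdisj, hcov⟩ := Vitali.exists_disjoint_subfamily_covering_enlargement_closedBall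
    (univ : Set A) (fun a => (a : Eu n)) (fun a => 2 * ρ a) (2 * ρ₀) (fun a _ => by linarith [hρ1 a]) 5 (by norm_num)
  have hcount : u.Countable := hdisj.countable_of_nonempty_interior fun a _ => by
    refine ⟨a, ?_⟩
    refine interior_mono Metric.ball_subset_closedBall ?_
    rw [Metric.isOpen_ball.interior_eq]
    exact Metric.mem_ball_self (by linarith [hρ0 a])
  have hcov' : A ⊆ ⋃ a ∈ u, Metric.closedBall (a : Eu n) (10 * ρ a) := by
    intro x hx
    obtain ⟨b, hb, hsub⟩ := hcov ⟨x, hx⟩ (mem_univ _)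
    refine mem_iUnion₂.2 ⟨b, hb, ?_⟩
    have := hsub (Metric.mem_closedBall_self (by linarith [hρ0 ⟨x, hx⟩]))
    rwa [← mul_assoc, show (5 : ℝ) * 2 = 10 by norm_num] at this
  have hA1 : μH[(n : ℝ)] A = μ₁ A := by
    rw [hμ₁, withDensity_apply _ hAm, hμ, Measure.restrict_restrict hAm, inter_eq_left.2 inter_subset_left]
    rw [setLIntegral_congr_fun (g := fun _ => 1) hAm fun x hx => by simp [show h x = 1 from hx.2]]
    simp
  calc μH[(n : ℝ)] A = μ₁ A := hA1
    _ ≤ μ₁ (⋃ a ∈ u, Metric.closedBall (a : Eu n) (10 * ρ a)) := measure_mono hcov'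
    _ ≤ ∑' a : u, μ₁ (Metric.closedBall (a : Eu n) (10 * ρ a)) := measure_biUnion_le _ hcount _
    _ ≤ ∑' a : u, ENNReal.ofReal (4 * 10 ^ n * ρ₀) * μ₂ (Metric.closedBall (a : Eu n) (2 * ρ a)) :=
        ENNReal.tsum_le_tsum fun a => hρ2 a
    _ = ENNReal.ofReal (4 * 10 ^ n * ρ₀) * μ₂ (⋃ a ∈ u, Metric.closedBall (a : Eu n) (2 * ρ a)) := by
        rw [ENNReal.tsum_mul_left, measure_biUnion hcount hdisj fun a _ => Metric.isClosed_closedBall.measurableSet]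
    _ ≤ ENNReal.ofReal (4 * 10 ^ n * ρ₀) * μ₂ univ := by gcongr; exact subset_univ _
    _ = _ := by rw [hμ₂, withDensity_apply _ MeasurableSet.univ, Measure.restrict_univ]

/-- weak-type constant -/
def cw (n : ℕ) : ℝ := 4 * 10 ^ n * (4 / cden n) ^ (1 / (n : ℝ))

lemma cw_pos : 0 < cw n := by
  have := cden_pos (n := n)
  unfold cw; positivity

theorem weak_type (hn : n ≠ 0) (M : Hypersurface n) {K : Set (Eu n)} (hK : IsCompact K) (hKM : K ⊆ M.carrier)
    {h : Eu n → ℝ} (hh : ContDiff ℝ 1 h) (hnn : ∀ x, 0 ≤ h x)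
    (h0 : ∀ x ∈ M.carrier, x ∉ K → h x = 0) :
    μH[(n : ℝ)] (K ∩ {x | h x = 1}) ≤ ENNReal.ofReal (cw n) * (∫⁻ x in K, ENNReal.ofReal (h x) ∂μH[(n : ℝ)]) ^ (1 / (n : ℝ)) *
      ∫⁻ x in K, ENNReal.ofReal (rhs M h x) ∂μH[(n : ℝ)] := by
  have hc := cden_pos (n := n)
  rcases eq_empty_or_nonempty (K ∩ {x | h x = 1}) with he | ⟨ξ, hξK, hξ1⟩
  · simp [he]
  set m := ∫ x in K, h x ∂μH[(n : ℝ)] with hm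
  have hm0 : 0 < m := by
    obtain ⟨σ₀, hσ₀, hσ⟩ := density M hK hKM hh.continuous hnn h0 (hKM hξK) hξ1
    have h1 := hσ (σ₀ / 2) (by positivity) (by linarith)
    have h2 : ∫ x in K ∩ Metric.closedBall ξ (σ₀ / 2), h x ∂μH[(n : ℝ)] ≤ m :=
      setIntegral_mono_set (integrableOn_K M hK hKM hh.continuous) (Eventually.of_forall hnn)
        (Eventually.of_forall inter_subset_left)
    have h3 : 0 < cden n * (σ₀ / 2) ^ n := by positivity
    linarith
  set ρ₀ := (4 * m / cden n) ^ (1 / (n : ℝ)) with hρ₀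
  have hρ0 : 0 < ρ₀ := by positivity
  have hpow : ρ₀ ^ n = 4 * m / cden n := by
    rw [hρ₀, one_div, Real.rpow_inv_natCast_pow (by positivity) hn]
  have := weak_aux M hK hKM hh hnn h0 hρ0 (by
    rw [hpow, mul_div_cancel₀ _ hc.ne', ← hm]; linarith)
  refine this.trans (le_of_eq ?_)
  congr 1
  rw [← ofReal_integral_eq_lintegral_ofReal (integrableOn_K M hK hKM hh.continuous) (Eventually.of_forall hnn),
    ENNReal.ofReal_rpow_of_pos hm0, ← ENNReal.ofReal_mul cw_pos.le, cw, hρ₀, mul_assoc (4 * 10 ^ n),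
    ← Real.mul_rpow (by positivity) hm0.le]
  congr 3
  ring
end MSA

namespace MSA
open Set Filter Topology
open scoped ENNReal NNReal

theorem two_zpow_ne_zero (k : ℤ) : (2:ℝ≥0∞)^k ≠ 0 := (ENNReal.zpow_pos (by norm_num) (by norm_num) k).ne'
theorem two_zpow_ne_top (k : ℤ) : (2:ℝ≥0∞)^k ≠ ⊤ := (ENNReal.zpow_lt_top (by norm_num) (by norm_num) k).ne

theorem two_zpow_succ (k : ℤ) : (2:ℝ≥0∞)^(k+1) = 2^k * 2 := by
  rw [ENNReal.zpow_add (by norm_num) (by norm_num), zpow_one]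

theorem two_zpow_mono {k l : ℤ} (h : k ≤ l) : (2:ℝ≥0∞)^k ≤ 2^l :=
  ENNReal.zpow_le_of_le (by norm_num) h

theorem geom1 {s : ℝ} (hs : 1 ≤ s) {t : ℝ≥0∞} (ht : t ≠ ⊤) :
    (∑' k : ℤ, if (2:ℝ≥0∞)^k ≤ t then ((2:ℝ≥0∞)^k)^s else 0) ≤ 2 * t^s := by
  rcases eq_or_ne t 0 with h0 | h0
  · subst h0
    have : ∀ k : ℤ, ¬ ((2:ℝ≥0∞)^k ≤ 0) := fun k h => two_zpow_ne_zero k (le_antisymm h bot_le)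
    simp [this]
  obtain ⟨m, hm1, hm2⟩ := ENNReal.exists_mem_Ico_zpow h0 ht (y := 2) (by norm_num) (by norm_num)
  have hinj : Function.Injective (fun j : ℕ => m - (j:ℤ)) := by
    intro a b h; simpa using h
  rw [← hinj.tsum_eq]
  · calc (∑' j : ℕ, if (2:ℝ≥0∞)^(m - (j:ℤ)) ≤ t then ((2:ℝ≥0∞)^(m-(j:ℤ)))^s else 0)
        ≤ ∑' j : ℕ, t^s * (2⁻¹)^j := by
          refine ENNReal.tsum_le_tsum fun j => ?_
          split_ifs
          · have e : (2:ℝ≥0∞)^(m - (j:ℤ)) = 2^m * (2⁻¹)^j := by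
              rw [sub_eq_add_neg, ENNReal.zpow_add (by norm_num) (by norm_num), ENNReal.zpow_neg, zpow_natCast,
                ENNReal.inv_pow]
            rw [e, ENNReal.mul_rpow_of_nonneg _ _ (by linarith)]
            refine mul_le_mul' (ENNReal.rpow_le_rpow hm1 (by linarith)) ?_
            have : ((2:ℝ≥0∞)⁻¹)^j ≤ 1 := pow_le_one₀ bot_le (by simp)
            calc (((2:ℝ≥0∞)⁻¹)^j)^s ≤ (((2:ℝ≥0∞)⁻¹)^j)^(1:ℝ) :=
                  ENNReal.rpow_le_rpow_of_exponent_ge this hs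
              _ = _ := ENNReal.rpow_one _
          · exact bot_le
      _ = 2 * t^s := by
          rw [ENNReal.tsum_mul_left, ENNReal.tsum_geometric, ENNReal.one_sub_inv_two, inv_inv, mul_comm]
  · intro k hk
    simp only [Function.mem_support, ne_eq, ite_eq_right_iff, Classical.not_imp] at hk
    have : k < m + 1 := by
      by_contra hc
      exact absurd (lt_of_le_of_lt (hk.1) hm2) (not_lt.2 (two_zpow_mono (not_lt.1 hc)))
    refine ⟨(m - k).toNat, ?_⟩
    simp only; omega

theorem geom2 {q : ℝ} (hq : 0 < q) {t : ℝ≥0∞} (ht : t ≠ ⊤) :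
    t^q ≤ 2^q * ∑' k : ℤ, if (2:ℝ≥0∞)^k ≤ t then ((2:ℝ≥0∞)^k)^q else 0 := by
  rcases eq_or_ne t 0 with h0 | h0
  · subst h0; simp [ENNReal.zero_rpow_of_pos hq]
  obtain ⟨m, hm1, hm2⟩ := ENNReal.exists_mem_Ico_zpow h0 ht (y := 2) (by norm_num) (by norm_num)
  calc t^q ≤ ((2:ℝ≥0∞)^(m+1))^q := ENNReal.rpow_le_rpow hm2.le hq.le
    _ = 2^q * ((2:ℝ≥0∞)^m)^q := by
      rw [two_zpow_succ, ENNReal.mul_rpow_of_nonneg _ _ hq.le, mul_comm]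
    _ ≤ _ := by
      gcongr
      refine le_trans ?_ (ENNReal.le_tsum m)
      rw [if_pos hm1]

theorem holder_set {X : Type*} [MeasurableSpace X] (μ : Measure X) {F : X → ℝ≥0∞} (hF : Measurable F)
    {p : ℝ} (hp : 1 ≤ p) (S : Set X) :
    ∫⁻ x in S, F x ∂μ ≤ (μ S)^(1-1/p) * (∫⁻ x in S, F x ^ p ∂μ)^(1/p) := by
  have hp0 : 0 < p := by linarith
  have h1 : 1/p ≤ 1 := by rw [div_le_one hp0]; exact hp
  have := ENNReal.lintegral_mul_norm_pow_le (μ := μ.restrict S) (f := fun _ => 1) (g := fun x => F x ^ p)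
    aemeasurable_const (hF.pow_const p).aemeasurable (p := 1 - 1/p) (q := 1/p) (by linarith) (by positivity) (by ring)
  simp only [ENNReal.one_rpow, one_mul, ← ENNReal.rpow_mul, mul_one_div_cancel hp0.ne', ENNReal.rpow_one,
    lintegral_const, Measure.restrict_apply_univ] at this
  exact this

/-- discrete summation step -/
theorem seq_step {p q N : ℝ} (hp : 1 ≤ p) (hN : 0 < N) (hq : 1 ≤ q) (hpq : 1/q = 1/p - 1/N)
    {A b : ℤ → ℝ≥0∞} {D : ℝ≥0∞}
    (hA : ∀ k, A (k+1) ≤ D * (A k)^(1-1/q) * (b k)^(1/p)) (hfin : ∑' k, A k ≠ ⊤) :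
    (∑' k, A k)^(p/q) ≤ D^p * ∑' k, b k := by
  have hp0 : 0 < p := by linarith
  have hq0 : 0 < q := by linarith
  have h1q : 1/q ≤ 1 := by rw [div_le_one hq0]; exact hq
  have hol : ∑' k, (A k)^(1-1/q) * (b k)^(1/q) ≤ (∑' k, A k)^(1-1/q) * (∑' k, b k)^(1/q) := by
    have := ENNReal.lintegral_mul_norm_pow_le (μ := (Measure.count : Measure ℤ)) (f := A) (g := b)
      (measurable_of_countable _).aemeasurable (measurable_of_countable _).aemeasurable (p := 1 - 1/q) (q := 1/q)
      (by linarith) (by positivity) (by ring)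
    simpa only [lintegral_count] using this
  set As := ∑' k, A k with hAs
  set B := ∑' k, b k with hB
  have key : As ≤ D * As^(1-1/q) * B^(1/p) := by
    calc As = ∑' k, A (k+1) := ((Equiv.addRight (1:ℤ)).tsum_eq A).symm
      _ ≤ ∑' k, (D * B^(1/N)) * ((A k)^(1-1/q) * (b k)^(1/q)) := by
          refine ENNReal.tsum_le_tsum fun k => (hA k).trans ?_
          have e : (b k)^(1/p) = (b k)^(1/q) * (b k)^(1/N) := by
            rw [← ENNReal.rpow_add_of_nonneg _ _ (by positivity) (by positivity), hpq]; congr 1; ring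
          rw [e]
          have : (b k)^(1/N) ≤ B^(1/N) := ENNReal.rpow_le_rpow (ENNReal.le_tsum k) (by positivity)
          calc D * A k ^ (1-1/q) * (b k ^ (1/q) * b k ^ (1/N)) ≤ D * A k ^ (1-1/q) * (b k ^ (1/q) * B ^ (1/N)) := by
                gcongr
            _ = _ := by ring
      _ ≤ (D * B^(1/N)) * (As^(1-1/q) * B^(1/q)) := by
          rw [ENNReal.tsum_mul_left]; gcongr
      _ = D * As^(1-1/q) * (B^(1/q) * B^(1/N)) := by ring
      _ = _ := by
          rw [← ENNReal.rpow_add_of_nonneg _ _ (by positivity) (by positivity), hpq]; congr 2; ring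
  rcases eq_or_ne As 0 with h0 | h0
  · rw [h0, ENNReal.zero_rpow_of_pos (by positivity)]; exact bot_le
  have k2 : As^(1/q) ≤ D * B^(1/p) := by
    have e : As = As^(1-1/q) * As^(1/q) := by
      rw [← ENNReal.rpow_add_of_nonneg _ _ (by linarith) (by positivity)]; simp
    have hne : As^(1-1/q) ≠ 0 := by
      rw [ne_eq, ENNReal.rpow_eq_zero_iff]; push Not; exact ⟨fun h => absurd h h0, fun h => absurd h hfin⟩
    have hnt : As^(1-1/q) ≠ ⊤ := ENNReal.rpow_ne_top_of_nonneg (by linarith) hfin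
    have k3 : As^(1-1/q) * As^(1/q) ≤ As^(1-1/q) * (D * B^(1/p)) := by
      rw [← e]; exact key.trans (le_of_eq (by ring))
    exact (ENNReal.mul_le_mul_iff_right hne hnt).1 k3
  calc As^(p/q) = (As^(1/q))^p := by rw [← ENNReal.rpow_mul]; congr 1; ring
    _ ≤ (D * B^(1/p))^p := ENNReal.rpow_le_rpow k2 hp0.le
    _ = D^p * B := by
      rw [ENNReal.mul_rpow_of_nonneg _ _ hp0.le, ← ENNReal.rpow_mul, one_div_mul_cancel hp0.ne', ENNReal.rpow_one]

/-- level-set recursion in rpow form -/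
theorem level_step {p q N : ℝ} (hp : 1 ≤ p) (hN : 0 < N) (hq : 1 ≤ q) (hpq : 1/q = 1/p - 1/N)
    {a a' C I J c1 b : ℝ≥0∞} {k : ℤ}
    (h1 : a' ≤ C * a^(1/N) * ((2:ℝ≥0∞)^k)⁻¹ * I) (h2 : I ≤ a^(1-1/p) * J^(1/p)) (h3 : J ≤ c1 * b) :
    ((2:ℝ≥0∞)^(k+1))^q * a' ≤ (2^q * C * c1^(1/p)) * (((2:ℝ≥0∞)^k)^q * a)^(1-1/q) * b^(1/p) := by
  have hp0 : 0 < p := by linarith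
  have hq0 : 0 < q := by linarith
  have h1q : 1/q ≤ 1 := by rw [div_le_one hq0]; exact hq
  have h1p : 1/p ≤ 1 := by rw [div_le_one hp0]; exact hp
  have e1 : (((2:ℝ≥0∞)^k)^q * a)^(1-1/q) = ((2:ℝ≥0∞)^k)^q * ((2:ℝ≥0∞)^k)⁻¹ * (a^(1/N) * a^(1-1/p)) := by
    rw [ENNReal.mul_rpow_of_nonneg _ _ (by linarith), ← ENNReal.rpow_mul,
      ← ENNReal.rpow_add_of_nonneg _ _ (by positivity) (by linarith)]
    congr 1
    · rw [← ENNReal.rpow_neg_one, ← ENNReal.rpow_add _ _ (two_zpow_ne_zero k) (two_zpow_ne_top k)]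
      congr 1; field_simp; ring
    · congr 1; rw [hpq]; ring
  have e2 : ((2:ℝ≥0∞)^(k+1))^q = 2^q * ((2:ℝ≥0∞)^k)^q := by
    rw [two_zpow_succ, ENNReal.mul_rpow_of_nonneg _ _ hq0.le, mul_comm]
  rw [e1, e2]
  calc 2^q * ((2:ℝ≥0∞)^k)^q * a' ≤ 2^q * ((2:ℝ≥0∞)^k)^q * (C * a^(1/N) * ((2:ℝ≥0∞)^k)⁻¹ * (a^(1-1/p) * (c1 * b)^(1/p))) := by
        gcongr
        refine h1.trans ?_
        gcongr
        refine h2.trans ?_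
        gcongr
    _ = _ := by
        rw [ENNReal.mul_rpow_of_nonneg _ _ (by positivity : 0 ≤ 1/p)]; ring

theorem dyadic {X : Type*} [MeasurableSpace X] (μ : Measure X) {T g H : X → ℝ≥0∞}
    (hT : Measurable T) (hg : Measurable g) (hH : Measurable H) (hTt : ∀ x, T x ≠ ⊤)
    {p q N : ℝ} (hp : 1 ≤ p) (hN : 0 < N) (hq : 1 ≤ q) (hpq : 1/q = 1/p - 1/N) {C : ℝ≥0∞}
    (hW : ∀ k : ℤ, μ {x | (2:ℝ≥0∞)^(k+1) ≤ T x} ≤ C * (μ {x | (2:ℝ≥0∞)^k ≤ T x})^(1/N) * ((2:ℝ≥0∞)^k)⁻¹ *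
      ∫⁻ x in {x | (2:ℝ≥0∞)^k ≤ T x},
        (({x | (2:ℝ≥0∞)^k ≤ T x} \ {x | (2:ℝ≥0∞)^(k+1) ≤ T x}).indicator g x + (2:ℝ≥0∞)^k * H x) ∂μ)
    (hfin : ∫⁻ x, T x ^ q ∂μ ≠ ⊤) :
    (∫⁻ x, T x ^ q ∂μ)^(p/q) ≤ (2^p * ((2^q * C * (2^(p-1))^(1/p))^p * 2)) *
      ∫⁻ x, (g x ^ p + (H x * T x)^p) ∂μ := by
  have hp0 : 0 < p := by linarith
  have hq0 : 0 < q := by linarith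
  set S : ℤ → Set X := fun k => {x | (2:ℝ≥0∞)^k ≤ T x} with hS
  set E : ℤ → Set X := fun k => S k \ S (k+1) with hE
  have mS : ∀ k, MeasurableSet (S k) := fun k => measurableSet_le measurable_const hT
  have mE : ∀ k, MeasurableSet (E k) := fun k => (mS k).diff (mS (k+1))
  have hpw : ∀ s : ℝ, Measurable fun x => T x ^ s := fun s => hT.pow_const s
  set A : ℤ → ℝ≥0∞ := fun k => ((2:ℝ≥0∞)^k)^q * μ (S k) with hA
  set b : ℤ → ℝ≥0∞ := fun k => ∫⁻ x in E k, g x ^ p ∂μ + ((2:ℝ≥0∞)^k)^p * ∫⁻ x in S k, H x ^ p ∂μ with hb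
  have layer : ∀ s : ℝ, ∀ F : X → ℝ≥0∞, Measurable F →
      ∑' k, ((2:ℝ≥0∞)^k)^s * ∫⁻ x in S k, F x ∂μ =
        ∫⁻ x, F x * ∑' k : ℤ, (if (2:ℝ≥0∞)^k ≤ T x then ((2:ℝ≥0∞)^k)^s else 0) ∂μ := by
    intro s F hF
    simp_rw [← ENNReal.tsum_mul_left]
    rw [lintegral_tsum]
    · refine tsum_congr fun k => ?_
      rw [← lintegral_indicator (mS k), ← lintegral_const_mul _ (hF.indicator (mS k))]
      refine lintegral_congr fun x => ?_
      by_cases hx : (2:ℝ≥0∞)^k ≤ T x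
      · rw [indicator_of_mem (show x ∈ S k from hx), if_pos hx, mul_comm]
      · rw [indicator_of_notMem (show x ∉ S k from hx), if_neg hx]; simp
    · intro k
      exact (hF.mul (Measurable.ite (mS k) measurable_const measurable_const)).aemeasurable
  have hAeq : ∑' k, A k = ∫⁻ x, ∑' k : ℤ, (if (2:ℝ≥0∞)^k ≤ T x then ((2:ℝ≥0∞)^k)^q else 0) ∂μ := by
    have := layer q (fun _ => 1) measurable_const
    simpa only [lintegral_const, one_mul, Measure.restrict_apply_univ] using this
  have hA1 : ∑' k, A k ≠ ⊤ := by
    rw [hAeq]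
    refine ne_top_of_le_ne_top (ENNReal.mul_ne_top (by norm_num : (2:ℝ≥0∞) ≠ ⊤) hfin) ?_
    rw [← lintegral_const_mul _ (hpw q)]
    exact lintegral_mono fun x => geom1 hq (hTt x)
  have hA2 : ∫⁻ x, T x ^ q ∂μ ≤ 2^q * ∑' k, A k := by
    rw [hAeq, ← lintegral_const_mul' _ _ (ENNReal.rpow_ne_top_of_nonneg hq0.le (by norm_num))]
    exact lintegral_mono fun x => geom2 hq0 (hTt x)
  have hdisj : Pairwise (Function.onFun Disjoint E) := by
    have aux : ∀ i j : ℤ, i < j → Disjoint (E i) (E j) := by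
      intro i j hij
      rw [Set.disjoint_left]
      rintro x ⟨_, h2⟩ ⟨h3, _⟩
      exact h2 (le_trans (two_zpow_mono (by omega)) h3)
    intro i j hij
    rcases lt_or_gt_of_ne hij with h | h
    · exact aux i j h
    · exact (aux j i h).symm
  have hB : ∑' k, b k ≤ 2 * ∫⁻ x, (g x ^ p + (H x * T x)^p) ∂μ := by
    rw [lintegral_add_left (hg.pow_const p), mul_add]
    rw [ENNReal.tsum_add]
    refine add_le_add ?_ ?_
    · rw [← lintegral_iUnion mE hdisj]
      refine (setLIntegral_le_lintegral _ _).trans ?_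
      exact le_mul_of_one_le_left' (by norm_num)
    · rw [layer p _ (hH.pow_const p), ← lintegral_const_mul 2 (show Measurable fun x => (H x * T x)^p from (hH.mul hT).pow_const p)]
      refine lintegral_mono fun x => ?_
      rw [ENNReal.mul_rpow_of_nonneg _ _ hp0.le]
      calc H x ^ p * _ ≤ H x ^ p * (2 * T x ^ p) := by gcongr; exact geom1 hp (hTt x)
        _ = _ := by ring
  have hrec : ∀ k, A (k+1) ≤ (2^q * C * (2^(p-1))^(1/p)) * (A k)^(1-1/q) * (b k)^(1/p) := by
    intro k
    have mF : Measurable fun x => (E k).indicator g x + (2:ℝ≥0∞)^k * H x :=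
      (hg.indicator (mE k)).add (hH.const_mul _)
    refine level_step hp hN hq hpq (hW k) (holder_set μ mF hp (S k)) ?_
    calc ∫⁻ x in S k, ((E k).indicator g x + (2:ℝ≥0∞)^k * H x)^p ∂μ
        ≤ ∫⁻ x in S k, 2^(p-1) * ((E k).indicator (fun x => g x ^ p) x + ((2:ℝ≥0∞)^k)^p * H x ^ p) ∂μ := by
          refine lintegral_mono fun x => ?_
          refine (ENNReal.rpow_add_le_mul_rpow_add_rpow _ _ hp).trans ?_
          rw [ENNReal.mul_rpow_of_nonneg _ _ hp0.le]
          gcongr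
          by_cases hx : x ∈ E k
          · simp [hx]
          · simp [hx, ENNReal.zero_rpow_of_pos hp0]
      _ = 2^(p-1) * (∫⁻ x in S k, (E k).indicator (fun x => g x ^ p) x ∂μ
            + ((2:ℝ≥0∞)^k)^p * ∫⁻ x in S k, H x ^ p ∂μ) := by
          have m1 : Measurable ((E k).indicator (fun x => g x ^ p)) := (hg.pow_const p).indicator (mE k)
          have m2 : Measurable fun x => ((E k).indicator (fun x => g x ^ p) x + ((2:ℝ≥0∞)^k)^p * H x ^ p) :=
            m1.add ((hH.pow_const p).const_mul _)
          rw [lintegral_const_mul _ m2, lintegral_add_left m1,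
            lintegral_const_mul _ (hH.pow_const p)]
      _ ≤ 2^(p-1) * b k := by
          refine mul_le_mul' le_rfl (add_le_add ?_ le_rfl)
          calc ∫⁻ x in S k, (E k).indicator (fun x => g x ^ p) x ∂μ ≤ ∫⁻ x, (E k).indicator (fun x => g x ^ p) x ∂μ :=
                setLIntegral_le_lintegral _ _
            _ = _ := lintegral_indicator (mE k) _
  have fin := seq_step hp hN hq hpq hrec hA1
  calc (∫⁻ x, T x ^ q ∂μ)^(p/q) ≤ (2^q * ∑' k, A k)^(p/q) := by gcongr
    _ = 2^p * (∑' k, A k)^(p/q) := by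
        rw [ENNReal.mul_rpow_of_nonneg _ _ (by positivity), ← ENNReal.rpow_mul, mul_div_cancel₀ _ hq0.ne']
    _ ≤ 2^p * ((2^q * C * (2^(p-1))^(1/p))^p * (2 * ∫⁻ x, (g x ^ p + (H x * T x)^p) ∂μ)) := by
        gcongr
        exact fin.trans (by gcongr)
    _ = _ := by ring

end MSA

namespace MSA
open Set Filter Topology
open scoped ENNReal NNReal

/-- level cutoff -/
def Lc (t : ℝ) : ℝ := Real.smoothTransition (t^2 - 2)

lemma Lc_contDiff : ContDiff ℝ 1 Lc :=
  Real.smoothTransition.contDiff.comp ((contDiff_id.pow 2).sub contDiff_const)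
lemma Lc_nonneg (s : ℝ) : 0 ≤ Lc s := Real.smoothTransition.nonneg _
lemma Lc_le_one (s : ℝ) : Lc s ≤ 1 := Real.smoothTransition.le_one _
lemma Lc_one {s : ℝ} (h : 3 ≤ s^2) : Lc s = 1 := Real.smoothTransition.one_of_one_le (by linarith)
lemma Lc_zero {s : ℝ} (h : s^2 ≤ 2) : Lc s = 0 := Real.smoothTransition.zero_of_nonpos (by linarith)
lemma Lc_diff : Differentiable ℝ Lc := Lc_contDiff.differentiable (by simp)
lemma Lc_deriv1 {s : ℝ} (h : s^2 < 2) : deriv Lc s = 0 := by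
  have : Lc =ᶠ[𝓝 s] fun _ => 0 := by
    filter_upwards [(isOpen_lt (continuous_pow 2) continuous_const).mem_nhds (show s ∈ {z : ℝ | z^2 < 2} from h)]
      with z hz using Lc_zero (le_of_lt hz)
  rw [this.deriv_eq]; simp
lemma Lc_deriv2 {s : ℝ} (h : 3 < s^2) : deriv Lc s = 0 := by
  have : Lc =ᶠ[𝓝 s] fun _ => 1 := by
    filter_upwards [(isOpen_lt continuous_const (continuous_pow 2)).mem_nhds (show s ∈ {z : ℝ | 3 < z^2} from h)]
      with z hz using Lc_one (le_of_lt hz)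
  rw [this.deriv_eq]; simp
lemma Lc_deriv_bdd : ∃ C, 1 ≤ C ∧ ∀ s, |deriv Lc s| ≤ C := by
  have hs : HasCompactSupport (deriv Lc) := by
    refine HasCompactSupport.intro (K := Icc (-2) 2) isCompact_Icc fun s hs => ?_
    rw [mem_Icc, not_and_or, not_le, not_le] at hs
    refine Lc_deriv2 ?_
    rcases hs with hs | hs <;> nlinarith
  obtain ⟨C, hC⟩ := (hs.isCompact_range (Lc_contDiff.continuous_deriv (by simp))).isBounded.exists_norm_le
  exact ⟨max 1 C, le_max_left _ _, fun s => (hC _ ⟨s, rfl⟩).trans (le_max_right _ _)⟩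

lemma two_zpow_ofReal (k : ℤ) : (2:ℝ≥0∞)^k = ENNReal.ofReal ((2:ℝ)^k) := by
  have h : ∀ j : ℕ, (2:ℝ≥0∞)^j = ENNReal.ofReal ((2:ℝ)^j) := fun j => by
    rw [ENNReal.ofReal_pow (by norm_num)]; simp
  obtain ⟨j, rfl | rfl⟩ := k.eq_nat_or_neg
  · simpa using h j
  · rw [ENNReal.zpow_neg, zpow_neg, zpow_natCast, zpow_natCast, ENNReal.ofReal_inv_of_pos (by positivity), h]

lemma tgrad_comp (ν : Eu n → Eu n) {φ : Eu n → ℝ} (hφ : Differentiable ℝ φ) (a : ℝ) (x : Eu n) :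
    tgrad ν (fun y => Lc (a * φ y)) x = (deriv Lc (a * φ x) * a) • tgrad ν φ x := by
  refine ext_inner_right ℝ fun v => ?_
  rw [tgrad_inner, inner_smul_left, tgrad_inner]
  have h1 : HasFDerivAt (fun y => a * φ y) (a • fderiv ℝ φ x) x := (hφ x).hasFDerivAt.const_mul a
  have h2 := (Lc_diff (a * φ x)).hasDerivAt.comp_hasFDerivAt x h1
  have h3 : fderiv ℝ (fun y => Lc (a * φ y)) x = deriv Lc (a * φ x) • (a • fderiv ℝ φ x) := HasFDerivAt.fderiv h2
  rw [h3]
  simp [mul_assoc]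

lemma level_weak {C0 : ℝ} (hC1 : 1 ≤ C0) (hC0 : ∀ s, |deriv Lc s| ≤ C0) (hn : n ≠ 0) (M : Hypersurface n) {K : Set (Eu n)}
    (hK : IsCompact K) (hKM : K ⊆ M.carrier)
    {φ : Eu n → ℝ} (hφ : ContDiff ℝ 1 φ) (h0 : ∀ x ∈ M.carrier, x ∉ K → φ x = 0) (k : ℤ) :
    let μ := (μH[(n:ℝ)] : Measure (Eu n)).restrict K
    let T : Eu n → ℝ≥0∞ := fun x => ENNReal.ofReal |φ x|
    let g : Eu n → ℝ≥0∞ := fun x => ENNReal.ofReal ‖tgrad M.nu φ x‖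
    let H : Eu n → ℝ≥0∞ := fun x => ENNReal.ofReal |meanCurv M x|
    μ {x | (2:ℝ≥0∞)^(k+1) ≤ T x} ≤ ENNReal.ofReal (cw n * C0) * (μ {x | (2:ℝ≥0∞)^k ≤ T x})^(1/(n:ℝ)) * ((2:ℝ≥0∞)^k)⁻¹ *
      ∫⁻ x in {x | (2:ℝ≥0∞)^k ≤ T x},
        (({x | (2:ℝ≥0∞)^k ≤ T x} \ {x | (2:ℝ≥0∞)^(k+1) ≤ T x}).indicator g x + (2:ℝ≥0∞)^k * H x) ∂μ := by
  intro μ T g H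
  have mem : ∀ (j : ℤ) x, (2:ℝ≥0∞)^j ≤ T x ↔ (2:ℝ)^j ≤ |φ x| := by
    intro j x
    rw [two_zpow_ofReal]
    exact ENNReal.ofReal_le_ofReal_iff (abs_nonneg _)
  have mT : Measurable T := (ENNReal.continuous_ofReal.comp hφ.continuous.abs).measurable
  have mS : ∀ j : ℤ, MeasurableSet {x | (2:ℝ≥0∞)^j ≤ T x} := fun j => measurableSet_le measurable_const mT
  set c : ℝ := (2:ℝ)^k with hc
  have hcpos : 0 < c := by positivity
  have hc2 : (2:ℝ)^(k+1) = 2 * c := by rw [zpow_add_one₀ (by norm_num)]; ring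
  set h : Eu n → ℝ := fun y => Lc (c⁻¹ * φ y) with hh
  have hsq : ∀ x, (c⁻¹ * φ x)^2 = (|φ x| / c)^2 := by
    intro x; rw [div_pow, sq_abs, mul_pow, inv_pow]; field_simp
  have hlow : ∀ x, x ∉ {x | (2:ℝ≥0∞)^k ≤ T x} → (c⁻¹ * φ x)^2 < 2 := by
    intro x hx
    rw [mem_setOf_eq, mem, not_le] at hx
    have h1 : |φ x| / c < 1 := by rw [div_lt_one hcpos]; exact hx
    have h2 : 0 ≤ |φ x| / c := by positivity
    rw [hsq]; nlinarith
  have hhigh : ∀ x, x ∈ {x | (2:ℝ≥0∞)^(k+1) ≤ T x} → 3 < (c⁻¹ * φ x)^2 := by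
    intro x hx
    rw [mem_setOf_eq, mem, hc2] at hx
    have h1 : 2 ≤ |φ x| / c := by rw [le_div_iff₀ hcpos]; exact hx
    rw [hsq]; nlinarith
  have hcd : ContDiff ℝ 1 h := Lc_contDiff.comp (contDiff_const.mul hφ)
  have hw := weak_type hn M hK hKM hcd (fun x => Lc_nonneg _)
    (fun x hx hxK => by
      have : φ x = 0 := h0 x hx hxK
      exact Lc_zero (by simp [this]))
  have e1 : μ {x | (2:ℝ≥0∞)^(k+1) ≤ T x} ≤ μH[(n:ℝ)] (K ∩ {x | h x = 1}) := by
    rw [Measure.restrict_apply (mS _)]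
    exact measure_mono fun x hx => ⟨hx.2, Lc_one (hhigh x hx.1).le⟩
  have e2 : (∫⁻ x in K, ENNReal.ofReal (h x) ∂μH[(n:ℝ)]) ≤ μ {x | (2:ℝ≥0∞)^k ≤ T x} := by
    rw [← lintegral_indicator_one (mS k)]
    refine lintegral_mono fun x => ?_
    by_cases hx : x ∈ {x | (2:ℝ≥0∞)^k ≤ T x}
    · rw [indicator_of_mem hx]
      exact ENNReal.ofReal_le_one.2 (Lc_le_one _)
    · have : h x = 0 := Lc_zero (hlow x hx).le
      simp [this]
  have e3 : (∫⁻ x in K, ENNReal.ofReal (rhs M h x) ∂μH[(n:ℝ)]) ≤ ENNReal.ofReal C0 * ((2:ℝ≥0∞)^k)⁻¹ *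
      ∫⁻ x in {x | (2:ℝ≥0∞)^k ≤ T x},
        (({x | (2:ℝ≥0∞)^k ≤ T x} \ {x | (2:ℝ≥0∞)^(k+1) ≤ T x}).indicator g x + (2:ℝ≥0∞)^k * H x) ∂μ := by
    rw [← lintegral_indicator (mS k), ← lintegral_const_mul' _ _
      (ENNReal.mul_ne_top ENNReal.ofReal_ne_top (ENNReal.inv_ne_top.2 (two_zpow_ne_zero k)))]
    refine lintegral_mono fun x => ?_
    have et : tgrad M.nu h x = (deriv Lc (c⁻¹ * φ x) * c⁻¹) • tgrad M.nu φ x :=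
      tgrad_comp M.nu (hφ.differentiable (by simp)) c⁻¹ x
    have er : rhs M h x = |deriv Lc (c⁻¹ * φ x)| * c⁻¹ * ‖tgrad M.nu φ x‖ + |meanCurv M x| * h x := by
      rw [rhs, et, norm_smul, norm_mul, Real.norm_eq_abs, Real.norm_eq_abs, abs_of_pos (inv_pos.2 hcpos),
        abs_of_nonneg (Lc_nonneg _ : 0 ≤ h x)]
    by_cases hx : x ∈ {x | (2:ℝ≥0∞)^k ≤ T x}
    · rw [indicator_of_mem hx]
      have einv : ((2:ℝ≥0∞)^k)⁻¹ = ENNReal.ofReal c⁻¹ := by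
        rw [two_zpow_ofReal, ENNReal.ofReal_inv_of_pos hcpos]
      rw [er, ENNReal.ofReal_add (by positivity) (mul_nonneg (abs_nonneg _) (Lc_nonneg _)), mul_add]
      refine add_le_add ?_ ?_
      · by_cases hx2 : x ∈ {x | (2:ℝ≥0∞)^(k+1) ≤ T x}
        · rw [Lc_deriv2 (hhigh x hx2)]; simp
        · rw [indicator_of_mem (show x ∈ {x | (2:ℝ≥0∞)^k ≤ T x} \ {x | (2:ℝ≥0∞)^(k+1) ≤ T x} from ⟨hx, hx2⟩), einv, ← ENNReal.ofReal_mul (by linarith),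
            ← ENNReal.ofReal_mul (by positivity)]
          apply ENNReal.ofReal_le_ofReal
          gcongr
          exact hC0 _
      · rw [einv, two_zpow_ofReal, ← ENNReal.ofReal_mul (by linarith), ← ENNReal.ofReal_mul (by positivity),
          ← ENNReal.ofReal_mul (by positivity)]
        apply ENNReal.ofReal_le_ofReal
        have : h x ≤ 1 := Lc_le_one _
        have h2 := abs_nonneg (meanCurv M x)
        calc |meanCurv M x| * h x ≤ |meanCurv M x| * C0 := by gcongr; linarith
          _ = C0 * c⁻¹ * (c * |meanCurv M x|) := by field_simp
    · have z : h x = 0 := Lc_zero (hlow x hx).le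
      rw [er, Lc_deriv1 (hlow x hx), z]; simp
  calc μ {x | (2:ℝ≥0∞)^(k+1) ≤ T x} ≤ _ := e1.trans hw
    _ ≤ ENNReal.ofReal (cw n) * (μ {x | (2:ℝ≥0∞)^k ≤ T x})^(1/(n:ℝ)) * _ := by
        refine mul_le_mul' (mul_le_mul' le_rfl (ENNReal.rpow_le_rpow e2 (by positivity))) e3
    _ = _ := by rw [ENNReal.ofReal_mul cw_pos.le]; ring

lemma vanish_tgrad (M : Hypersurface n) {K : Set (Eu n)} (hK : IsCompact K)
    {φ : Eu n → ℝ} (hφ : ContDiff ℝ 1 φ) (h0 : ∀ x ∈ M.carrier, x ∉ K → φ x = 0)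
    {x : Eu n} (hx : x ∈ M.carrier) (hxK : x ∉ K) : tgrad M.nu φ x = 0 := by
  refine ext_inner_right ℝ fun v => ?_
  rw [tgrad_inner, inner_zero_left]
  have ht : ⟪v - ⟪v, M.nu x⟫ • M.nu x, M.nu x⟫ = 0 := by
    rw [inner_sub_left, inner_smul_left, nu_nu M hx]; simp
  have he : φ =ᶠ[𝓝[M.carrier] x] fun _ => (0:ℝ) := by
    filter_upwards [self_mem_nhdsWithin, nhdsWithin_le_nhds (hK.isClosed.isOpen_compl.mem_nhds hxK)] with y hy hyK
    exact h0 y hy hyK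
  rw [fderiv_tangent_congr M hx (hφ.differentiable (by simp) x) (differentiableAt_const _) he ht]
  simp

lemma toReal_lint {K : Set (Eu n)} (M : Hypersurface n) (hK : IsCompact K) (hKM : K ⊆ M.carrier)
    {F : Eu n → ℝ} (hF : Continuous F) (hnn : ∀ x, 0 ≤ F x) (hv : ∀ x ∈ M.carrier, x ∉ K → F x = 0) :
    ∫⁻ x in K, ENNReal.ofReal (F x) ∂μH[(n:ℝ)] = ENNReal.ofReal (∫ x, F x ∂surfMeasure M) := by
  rw [← ofReal_integral_eq_lintegral_ofReal (integrableOn_K M hK hKM hF) (ae_of_all _ hnn), surfMeasure,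
    setIntegral_eq_of_subset_of_forall_sdiff_eq_zero (measurable_carrier M) hKM fun x hx => hv x hx.1 hx.2]

theorem main (n : ℕ) (p : ℝ) (hp : 1 ≤ p) (hpn : p < n) :
    ∃ C : ℝ, 0 < C ∧ ∀ (M : Hypersurface n) (φ : Eu n → ℝ), C1cOn M.carrier φ →
      (∫ x, |φ x| ^ ((n : ℝ) * p / (n - p)) ∂surfMeasure M) ^ (((n : ℝ) - p) / n)
        ≤ C * ∫ x, ‖tgrad M.nu φ x‖ ^ p + |meanCurv M x * φ x| ^ p ∂surfMeasure M := by
  obtain ⟨C0, hC1, hC0⟩ := Lc_deriv_bdd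
  have hp0 : 0 < p := by linarith
  have hN : 0 < (n:ℝ) := by linarith
  have hn : n ≠ 0 := by rintro rfl; simp at hN
  have hd : 0 < (n:ℝ) - p := by linarith
  set q : ℝ := (n : ℝ) * p / (n - p) with hqdef
  have hq : 1 ≤ q := by rw [hqdef, le_div_iff₀ hd]; nlinarith
  have hq0 : 0 < q := by linarith
  have hpq : 1/q = 1/p - 1/(n:ℝ) := by rw [hqdef]; field_simp
  have hpdq : ((n : ℝ) - p) / n = p/q := by rw [hqdef]; field_simp
  set D : ℝ≥0∞ := 2^p * ((2^q * ENNReal.ofReal (cw n * C0) * (2^(p-1))^(1/p))^p * 2) with hD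
  have t2 : ∀ s : ℝ, 0 ≤ s → (2:ℝ≥0∞)^s ≠ ⊤ := fun s hs => ENNReal.rpow_ne_top_of_nonneg hs (by norm_num)
  have hDt : D ≠ ⊤ := by
    refine ENNReal.mul_ne_top (t2 p hp0.le) (ENNReal.mul_ne_top (ENNReal.rpow_ne_top_of_nonneg hp0.le ?_) (by norm_num))
    refine ENNReal.mul_ne_top (ENNReal.mul_ne_top (t2 q hq0.le) ENNReal.ofReal_ne_top) ?_
    exact ENNReal.rpow_ne_top_of_nonneg (by positivity) (t2 _ (by linarith))
  refine ⟨D.toReal + 1, by positivity, ?_⟩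
  rintro M φ ⟨hφ, K, hK, hKM, h0⟩
  have cH : Continuous fun x => meanCurv M x := continuous_meanCurv M
  have cg : Continuous fun x => tgrad M.nu φ x := continuous_tgrad M.smooth_nu.continuous hφ
  have cq : Continuous fun x => |φ x| ^ q := hφ.continuous.abs.rpow_const fun x => Or.inr hq0.le
  have cp : Continuous fun x => ‖tgrad M.nu φ x‖ ^ p + |meanCurv M x * φ x| ^ p :=
    (cg.norm.rpow_const fun x => Or.inr hp0.le).add
      ((cH.mul hφ.continuous).abs.rpow_const fun x => Or.inr hp0.le)
  have I1 := toReal_lint M hK hKM cq (fun x => by positivity)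
    (fun x hx hxK => by rw [h0 x hx hxK, abs_zero, Real.zero_rpow hq0.ne'])
  have I2 := toReal_lint M hK hKM cp (fun x => by positivity)
    (fun x hx hxK => by
      rw [h0 x hx hxK, vanish_tgrad M hK hφ h0 hx hxK]; simp [Real.zero_rpow hp0.ne'])
  have r1 : ∀ x, ENNReal.ofReal (|φ x| ^ q) = ENNReal.ofReal |φ x| ^ q := fun x =>
    (ENNReal.ofReal_rpow_of_nonneg (abs_nonneg _) hq0.le).symm
  have r2 : ∀ x, ENNReal.ofReal (‖tgrad M.nu φ x‖ ^ p + |meanCurv M x * φ x| ^ p)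
      = ENNReal.ofReal ‖tgrad M.nu φ x‖ ^ p + (ENNReal.ofReal |meanCurv M x| * ENNReal.ofReal |φ x|)^p := fun x => by
    rw [ENNReal.ofReal_add (by positivity) (by positivity), ← ENNReal.ofReal_mul (abs_nonneg _), ← abs_mul,
      ENNReal.ofReal_rpow_of_nonneg (norm_nonneg _) hp0.le, ENNReal.ofReal_rpow_of_nonneg (abs_nonneg _) hp0.le]
  simp_rw [r1] at I1
  simp_rw [r2] at I2
  have main := dyadic ((μH[(n:ℝ)] : Measure (Eu n)).restrict K)
    (ENNReal.continuous_ofReal.comp hφ.continuous.abs).measurable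
    (ENNReal.continuous_ofReal.comp cg.norm).measurable
    (ENNReal.continuous_ofReal.comp cH.abs).measurable (fun x => ENNReal.ofReal_ne_top) hp hN hq hpq
    (fun k => level_weak hC1 hC0 hn M hK hKM hφ h0 k)
    (by
      have : ∫⁻ x in K, ENNReal.ofReal |φ x| ^ q ∂μH[(n:ℝ)] ≠ ⊤ := by rw [I1]; exact ENNReal.ofReal_ne_top
      exact this)
  replace main : (∫⁻ x in K, ENNReal.ofReal |φ x| ^ q ∂μH[(n:ℝ)])^(p/q) ≤ D * ∫⁻ x in K,
      (ENNReal.ofReal ‖tgrad M.nu φ x‖ ^ p + (ENNReal.ofReal |meanCurv M x| * ENNReal.ofReal |φ x|)^p) ∂μH[(n:ℝ)] := main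
  have n1 : 0 ≤ ∫ x, |φ x| ^ q ∂surfMeasure M := integral_nonneg fun x => by positivity
  have n2 : 0 ≤ ∫ x, ‖tgrad M.nu φ x‖ ^ p + |meanCurv M x * φ x| ^ p ∂surfMeasure M :=
    integral_nonneg fun x => by positivity
  rw [I1, I2, ENNReal.ofReal_rpow_of_nonneg n1 (by positivity), ← ENNReal.ofReal_toReal hDt,
    ← ENNReal.ofReal_mul (by positivity), ENNReal.ofReal_le_ofReal_iff (by positivity)] at main
  rw [hpdq]
  nlinarith

end MSA

/-- The Michael–Simon and Allard Sobolev inequality on hypersurfaces: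
`‖φ‖_{L^{p*}(M)}^p ≤ C(n,p) ∫_M (|∇_T φ|^p + |Hφ|^p)` for `p ∈ [1,n)`, `p* = np/(n−p)`. -/
theorem michael_simon_allard_sobolev (n : ℕ) (p : ℝ) (hp : 1 ≤ p) (hpn : p < n) :
    ∃ C : ℝ, 0 < C ∧ ∀ (M : Hypersurface n) (φ : Eu n → ℝ), C1cOn M.carrier φ →
      (∫ x, |φ x| ^ ((n : ℝ) * p / (n - p)) ∂surfMeasure M) ^ (((n : ℝ) - p) / n)
        ≤ C * ∫ x, ‖tgrad M.nu φ x‖ ^ p + |meanCurv M x * φ x| ^ p ∂surfMeasure M := by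
  exact MSA.main n p hp hpn
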